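/- If G is a 48-edge-connected bipartite finite simple graph and the number of edges |E(G)| is divisible by 5, then G admits a P_5-decomposition, i.e., a decomposition into copies of the path of length 5. -/

import Mathlib

open SimpleGraph

/-- A graph `G` is `k`-edge-connected if it remains connected after the deletion of
any fewer than `k` edges. -/
def IsKEdgeConnected {V : Type} (G : SimpleGraph V) (k : ℕ) : Prop :=
  ∀ S : Finset (Sym2 V), S.card < k → (G.deleteEdges ↑S).Connected

/-- `D` is a decomposition of `G` into copies of `T`: a set of pairwise edge-disjoint
subgraphs of `G`, each isomorphic to `T`, whose union is `G`. -/
def IsDecompInto {V W : Type} (G : SimpleGraph V) (T : SimpleGraph W)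
    (D : Set G.Subgraph) : Prop :=
  (∀ H ∈ D, Nonempty (H.coe ≃g T)) ∧
  (∀ H ∈ D, ∀ K ∈ D, H ≠ K → Disjoint H.edgeSet K.edgeSet) ∧
  (⋃ H ∈ D, H.edgeSet) = G.edgeSet

namespace P5

/-! Rado theorem for submodular functions -/

lemma rado {ι ε : Type*} [Fintype ι] [DecidableEq ι] [DecidableEq ε] (ρ : Finset ε → ℕ)
    (mono : ∀ S T, S ⊆ T → ρ S ≤ ρ T)
    (sub : ∀ S T, ρ (S ∪ T) + ρ (S ∩ T) ≤ ρ S + ρ T) (r : ℕ) :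
    ∀ (n : ℕ) (X : ι → Finset ε), ∑ i, (X i).card = n → (∀ i, (X i).Nonempty) →
      (∀ I : Finset ι, r ≤ ρ (I.biUnion X) + (Iᶜ).card) →
      ∃ f : ι → ε, (∀ i, f i ∈ X i) ∧ r ≤ ρ (Finset.univ.image f) := by
  intro n
  induction n using Nat.strong_induction_on with
  | _ n ih =>
  intro X hn hne hI
  by_cases h1 : ∀ i, (X i).card ≤ 1
  · choose f hf using hne
    refine ⟨f, hf, ?_⟩
    have := hI Finset.univ
    simp only [Finset.compl_univ, Finset.card_empty, add_zero] at this
    refine this.trans (mono _ _ ?_)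
    intro x hx
    simp only [Finset.mem_biUnion, Finset.mem_univ, true_and] at hx
    obtain ⟨i, hi⟩ := hx
    simp only [Finset.mem_image, Finset.mem_univ, true_and]
    exact ⟨i, Finset.card_le_one.1 (h1 i) _ (hf i) _ hi⟩
  · push Not at h1
    obtain ⟨i, hi⟩ := h1
    obtain ⟨x, hx, y, hy, hxy⟩ := Finset.one_lt_card.1 hi
    -- try to delete an element
    have key : ∀ z ∈ X i, (∃ t ∈ X i, t ≠ z) →
        (∀ I : Finset ι, r ≤ ρ (I.biUnion (Function.update X i ((X i).erase z))) + (Iᶜ).card) →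
        ∃ f : ι → ε, (∀ i, f i ∈ X i) ∧ r ≤ ρ (Finset.univ.image f) := by
      intro z hz ⟨t, ht, htz⟩ hc
      have hlt : ∑ j, (Function.update X i ((X i).erase z) j).card < n := by
        rw [← hn]
        apply Finset.sum_lt_sum
        · intro j _
          by_cases hj : j = i
          · subst hj; simp [Finset.card_le_card (Finset.erase_subset _ _)]
          · simp [hj]
        · exact ⟨i, Finset.mem_univ _, by simpa using Finset.card_erase_lt_of_mem hz⟩
      obtain ⟨f, hf, hr⟩ := ih _ hlt _ rfl (by
        intro j
        by_cases hj : j = i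
        · subst hj; simpa using ⟨t, Finset.mem_erase.2 ⟨htz, ht⟩⟩
        · simpa [hj] using hne j) hc
      refine ⟨f, fun j => ?_, hr⟩
      by_cases hj : j = i
      · subst hj
        have := hf j
        simp only [Function.update_self] at this
        exact Finset.mem_of_mem_erase this
      · simpa [hj] using hf j
    by_contra hcon
    have hx' : ¬ _ := fun h => hcon (key x hx ⟨y, hy, hxy.symm⟩ h)
    have hy' : ¬ _ := fun h => hcon (key y hy ⟨x, hx, hxy⟩ h)
    push Not at hx' hy'
    obtain ⟨I, hI1⟩ := hx'
    obtain ⟨J, hJ1⟩ := hy'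
    have aux : ∀ (z : ε) (I : Finset ι),
        ρ (I.biUnion (Function.update X i ((X i).erase z))) + (Iᶜ).card < r → i ∈ I := by
      intro z I h
      by_contra hiI
      have : I.biUnion (Function.update X i ((X i).erase z)) = I.biUnion X := by
        apply Finset.biUnion_congr rfl
        intro j hj
        have : j ≠ i := fun h => hiI (h ▸ hj)
        simp [this]
      rw [this] at h
      have := hI I
      omega
    have hiI := aux x I hI1
    have hiJ := aux y J hJ1
    set S := I.biUnion (Function.update X i ((X i).erase x)) with hS
    set T := J.biUnion (Function.update X i ((X i).erase y)) with hT
    have hU : (I ∪ J).biUnion X ⊆ S ∪ T := by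
      intro e he
      simp only [Finset.mem_biUnion, Finset.mem_union] at he
      obtain ⟨j, hj, hej⟩ := he
      simp only [hS, hT, Finset.mem_union, Finset.mem_biUnion]
      by_cases hji : j = i
      · subst hji
        by_cases hex : e = x
        · right; exact ⟨j, hiJ, by simp [hex, hxy, hx]⟩
        · left; exact ⟨j, hiI, by simp [hej, hex]⟩
      · rcases hj with hj | hj
        · left; exact ⟨j, hj, by simpa [hji] using hej⟩
        · right; exact ⟨j, hj, by simpa [hji] using hej⟩
    have hN : ((I ∩ J).erase i).biUnion X ⊆ S ∩ T := by
      intro e he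
      simp only [Finset.mem_biUnion, Finset.mem_erase, Finset.mem_inter] at he
      obtain ⟨j, ⟨hji, hj1, hj2⟩, hej⟩ := he
      simp only [hS, hT, Finset.mem_inter, Finset.mem_biUnion]
      exact ⟨⟨j, hj1, by simpa [hji] using hej⟩, ⟨j, hj2, by simpa [hji] using hej⟩⟩
    have e1 := hI (I ∪ J)
    have e2 := hI ((I ∩ J).erase i)
    have e3 := mono _ _ hU
    have e4 := mono _ _ hN
    have e5 := sub S T
    have c1 := Finset.card_union_add_card_inter I J
    have c2 : ((I ∩ J).erase i).card + 1 = (I ∩ J).card :=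
      Finset.card_erase_add_one (Finset.mem_inter.2 ⟨hiI, hiJ⟩)
    rw [Finset.card_compl] at e1 e2 hI1 hJ1
    have d1 := Finset.card_le_univ (I ∪ J)
    have d2 := Finset.card_le_univ I
    have d3 := Finset.card_le_univ J
    have d4 := Finset.card_le_univ ((I ∩ J).erase i)
    omega

end P5

namespace P5

variable {V : Type} [Fintype V] [DecidableEq V]

def dg (F : Finset (Sym2 V)) (v : V) : ℕ := (F.filter (fun e => v ∈ e)).card

def bd (e : Sym2 V) : V → ZMod 2 := fun v => if v ∈ e then 1 else 0

def sp (F : Finset (Sym2 V)) : Submodule (ZMod 2) (V → ZMod 2) :=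
  Submodule.span (ZMod 2) (bd '' (F : Set (Sym2 V)))

noncomputable def rk (F : Finset (Sym2 V)) : ℕ := Module.finrank (ZMod 2) (sp F)

lemma sp_mono {S T : Finset (Sym2 V)} (h : S ⊆ T) : sp S ≤ sp T :=
  Submodule.span_mono (Set.image_mono (by exact_mod_cast h))

lemma sp_union (S T : Finset (Sym2 V)) : sp (S ∪ T) = sp S ⊔ sp T := by
  simp [sp, Set.image_union, Submodule.span_union]

lemma rk_mono {S T : Finset (Sym2 V)} (h : S ⊆ T) : rk S ≤ rk T :=
  Submodule.finrank_mono (sp_mono h)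

lemma rk_sub (S T : Finset (Sym2 V)) : rk (S ∪ T) + rk (S ∩ T) ≤ rk S + rk T := by
  have h1 := Submodule.finrank_sup_add_finrank_inf_eq (sp S) (sp T)
  have h2 : rk (S ∩ T) ≤ Module.finrank (ZMod 2) ↥(sp S ⊓ sp T) :=
    Submodule.finrank_mono (le_inf (sp_mono Finset.inter_subset_left)
      (sp_mono Finset.inter_subset_right))
  unfold rk at *
  rw [sp_union]
  omega

lemma rk_le_card (S : Finset (Sym2 V)) : rk S ≤ S.card := by
  have h := finrank_span_finset_le_card (R := ZMod 2) (S.image (bd (V := V)))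
  have h2 := Finset.card_image_le (s := S) (f := (bd (V := V)))
  unfold rk sp
  rw [Finset.coe_image] at h
  unfold Set.finrank at h
  omega

lemma rk_le_add (S T : Finset (Sym2 V)) : rk S ≤ rk T + (S \ T).card := by
  have h1 := rk_sub T (S \ T)
  have h2 := rk_le_card (S \ T)
  have h3 : rk S ≤ rk (T ∪ S \ T) := rk_mono (by intro x; simp; tauto)
  omega

def sl {ε : Type*} [DecidableEq ε] {N : ℕ} (S : Finset (ε × Fin N)) (j : Fin N) : Finset ε :=
  (S.filter (fun z => z.2 = j)).image Prod.fst

lemma mem_sl {ε : Type*} [DecidableEq ε] {N : ℕ} (S : Finset (ε × Fin N)) (j : Fin N) (e : ε) :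
    e ∈ sl S j ↔ (e, j) ∈ S := by
  simp [sl]

lemma bunch (al : Sym2 V → V) (U : Finset (Sym2 V)) (g N : ℕ) (hg : 0 < g)
    (hU : ∀ I, I ⊆ U → g * (N * (rk U - rk I)) ≤ (U \ I).card) :
    ∃ C : Fin N → Finset (Sym2 V), (∀ j, C j ⊆ U) ∧ (∀ i j, i ≠ j → Disjoint (C i) (C j)) ∧
      (∀ j, rk (C j) = rk U) ∧
      ∀ a, ∑ j, ((C j).filter (fun e => al e = a)).card ≤
        ((U.filter (fun e => al e = a)).card + g - 1) / g := by
  classical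
  let Ua : V → Finset (Sym2 V) := fun a => U.filter (fun e => al e = a)
  have hidx : ∀ a, ∃ ix : Sym2 V → ℕ, (∀ e ∈ Ua a, ix e < (Ua a).card) ∧
      Set.InjOn ix (Ua a) := by
    intro a
    refine ⟨fun e => if h : e ∈ Ua a then ((Ua a).equivFin ⟨e, h⟩ : ℕ) else 0, ?_, ?_⟩
    · intro e he
      simp [he]
    · intro e he e' he' h
      simp only [Finset.mem_coe] at he he'
      simp only [he, he', dite_true] at h
      have := (Ua a).equivFin.injective (Fin.ext h)
      simpa using this
  choose ix hix1 hix2 using hidx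
  let key : Sym2 V → V × ℕ := fun e => (al e, ix (al e) e / g)
  let K : Finset (V × ℕ) := U.image key
  let gr : K → Finset (Sym2 V) := fun i => U.filter (fun e => key e = i.1)
  let X : K → Finset (Sym2 V × Fin N) := fun i => (gr i) ×ˢ Finset.univ
  have hgr : ∀ i, (gr i).card ≤ g := by
    intro i
    have : Set.MapsTo (ix i.1.1) (gr i) (Finset.Ico (g * i.1.2) (g * i.1.2 + g)) := by
      intro e he
      simp only [gr, key, Finset.coe_filter, Set.mem_ofPred_eq, Prod.ext_iff] at he
      obtain ⟨he, h1, h2⟩ := he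
      rw [← h1, ← h2]
      simp only [Finset.coe_Ico, Set.mem_Ico]
      constructor
      · exact Nat.mul_div_le _ _
      · exact Nat.lt_mul_div_succ _ hg
    have h2 : Set.InjOn (ix i.1.1) (gr i) := by
      apply (hix2 i.1.1).mono
      intro e he
      simp only [gr, key, Finset.coe_filter, Set.mem_ofPred_eq, Prod.ext_iff] at he
      simp [Ua, he.1, he.2.1]
    have := Finset.card_le_card_of_injOn _ this h2
    simpa using this
  by_cases hN : N = 0
  · subst hN
    exact ⟨fun j => ∅, fun j => j.elim0, fun j => j.elim0, fun j => j.elim0, by simp⟩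
  let ρ : Finset (Sym2 V × Fin N) → ℕ := fun S => ∑ j, rk (sl S j)
  obtain ⟨f, hf, hr⟩ := rado ρ
    (by
      intro S T h
      refine Finset.sum_le_sum fun j _ => rk_mono ?_
      intro e; simp only [mem_sl]; exact fun h' => h h')
    (by
      intro S T
      simp only [ρ, ← Finset.sum_add_distrib]
      refine Finset.sum_le_sum fun j _ => ?_
      have h1 : sl (S ∪ T) j = sl S j ∪ sl T j := by ext; simp [mem_sl]
      have h2 : sl (S ∩ T) j = sl S j ∩ sl T j := by ext; simp [mem_sl]
      rw [h1, h2]; exact rk_sub _ _)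
    (N * rk U) _ X rfl
    (by
      intro i
      obtain ⟨e, he, hi⟩ := Finset.mem_image.1 i.2
      exact ⟨(e, ⟨0, Nat.pos_of_ne_zero hN⟩), by simp [X, gr, he, hi]⟩)
    (by
      intro I
      have h1 : ∀ j, sl (I.biUnion X) j = I.biUnion gr := by
        intro j; ext e; simp [mem_sl, X]
      simp only [ρ, h1, Finset.sum_const, Finset.card_univ, Fintype.card_fin, smul_eq_mul]
      have hW : I.biUnion gr ⊆ U := by
        intro e; simp only [Finset.mem_biUnion, gr, Finset.mem_filter]; rintro ⟨i, _, h, _⟩; exact h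
      have h2 := hU _ hW
      have h3 : (U \ I.biUnion gr).card ≤ (Iᶜ).card * g := by
        refine le_trans (Finset.card_le_card (t := Iᶜ.biUnion gr) ?_)
          (Finset.card_biUnion_le_card_mul _ _ _ (fun i _ => hgr i))
        intro e he
        simp only [Finset.mem_sdiff, Finset.mem_biUnion, not_exists, not_and] at he
        have hk : key e ∈ K := Finset.mem_image_of_mem _ he.1
        simp only [Finset.mem_biUnion, Finset.mem_compl]
        refine ⟨⟨key e, hk⟩, ?_, by simp [gr, he.1]⟩
        intro h; exact he.2 _ h (by simp [gr, he.1])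
      have h4 : N * (rk U - rk (I.biUnion gr)) ≤ (Iᶜ).card := by
        apply Nat.le_of_mul_le_mul_left _ hg
        rw [mul_comm g (Iᶜ).card]; omega
      rw [Nat.mul_sub] at h4
      omega)
  have hCU : ∀ j, sl (Finset.univ.image f) j ⊆ U := by
    intro j e he
    rw [mem_sl] at he
    obtain ⟨i, _, hi⟩ := Finset.mem_image.1 he
    have := hf i
    rw [hi] at this
    simp only [X, gr, Finset.mem_product, Finset.mem_filter] at this
    exact this.1.1
  have hkey : ∀ i, key (f i).1 = i.1 := by
    intro i
    have := hf i
    simp only [X, gr, Finset.mem_product, Finset.mem_filter] at this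
    exact this.1.2
  refine ⟨fun j => sl (Finset.univ.image f) j, hCU, ?_, ?_, ?_⟩
  · intro i j hij
    rw [Finset.disjoint_left]
    intro e h1 h2
    rw [mem_sl] at h1 h2
    obtain ⟨i1, _, hi1⟩ := Finset.mem_image.1 h1
    obtain ⟨i2, _, hi2⟩ := Finset.mem_image.1 h2
    have e1 := hkey i1
    have e2 := hkey i2
    rw [hi1] at e1
    rw [hi2] at e2
    have : i1 = i2 := Subtype.ext (e1.symm.trans e2)
    subst this
    rw [hi1] at hi2
    exact hij (Prod.ext_iff.1 hi2).2
  · have hle : ∀ j ∈ Finset.univ, rk (sl (Finset.univ.image f) j) ≤ rk U := fun j _ => rk_mono (hCU j)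
    have hs : ∑ j, rk (sl (Finset.univ.image f) j) = ∑ j : Fin N, rk U := by
      apply le_antisymm (Finset.sum_le_sum hle)
      simpa [ρ] using hr
    intro j
    exact (Finset.sum_eq_sum_iff_of_le hle).1 hs j (Finset.mem_univ j)
  · intro a
    have h1 : ∑ j, ((sl (Finset.univ.image f) j).filter (fun e => al e = a)).card
        ≤ (Finset.univ.filter (fun i : K => i.1.1 = a)).card := by
      rw [← Finset.card_sigma]
      refine le_trans (Finset.card_le_card
        (t := (Finset.univ.filter (fun i : K => i.1.1 = a)).image
          (fun i => (⟨(f i).2, (f i).1⟩ : Σ _ : Fin N, Sym2 V))) ?_) Finset.card_image_le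
      rintro ⟨j, e⟩ h
      simp only [Finset.mem_sigma, Finset.mem_univ, true_and, Finset.mem_filter, mem_sl] at h
      obtain ⟨i, _, hi⟩ := Finset.mem_image.1 h.1
      refine Finset.mem_image.2 ⟨i, ?_, by rw [hi]⟩
      have := hkey i
      rw [hi] at this
      simp only [Finset.mem_filter, Finset.mem_univ, true_and]
      rw [← this]; exact h.2
    refine h1.trans ?_
    have : Set.MapsTo (fun i : K => i.1.2) (Finset.univ.filter (fun i : K => i.1.1 = a))
        (Finset.range (((Ua a).card + g - 1) / g)) := by
      rintro ⟨i, hiK⟩ hi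
      obtain ⟨e, he, rfl⟩ := Finset.mem_image.1 hiK
      simp only [Finset.coe_filter, Set.mem_ofPred_eq, Finset.mem_univ, true_and, key] at hi
      simp only [Finset.coe_range, Set.mem_Iio, key]
      subst hi
      have := hix1 (al e) e (by simp [Ua, he])
      rw [Nat.lt_iff_add_one_le, Nat.le_div_iff_mul_le hg, add_mul]
      have h5 := Nat.div_mul_le_self (ix (al e) e) g
      omega
    have h2 := Finset.card_le_card_of_injOn _ this (by
      rintro ⟨i, hi⟩ h ⟨i', hi'⟩ h' hh
      simp only [Finset.coe_filter, Set.mem_ofPred_eq, Finset.mem_univ, true_and] at h h' hh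
      exact Subtype.ext (Prod.ext (h.trans h'.symm) hh))
    simpa using h2

end P5

namespace P5

variable {V : Type} [Fintype V] [DecidableEq V]

/-- the graph with a given finite edge set -/
abbrev gr (F : Finset (Sym2 V)) : SimpleGraph V := fromEdgeSet (F : Set (Sym2 V))

def Conn (F : Finset (Sym2 V)) : Prop := ∀ u v, (gr F).Reachable u v

lemma bd_mk {u v : V} (h : u ≠ v) :
    bd s(u, v) = Pi.single u (1 : ZMod 2) + Pi.single v 1 := by
  funext w
  by_cases h1 : w = u
  · subst h1; simp [bd, h]
  · by_cases h2 : w = v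
    · subst h2; simp [bd, Ne.symm h]
    · simp [bd, h1, h2]

lemma reach_closed {H : SimpleGraph V} {P : V → Prop} (hP : ∀ x y, H.Adj x y → P x → P y)
    {u v : V} (h : H.Reachable u v) : P u → P v := by
  obtain ⟨p⟩ := h
  induction p with
  | nil => exact id
  | cons h _ ih => intro h'; exact ih (hP _ _ h h')

lemma zz (x : V → ZMod 2) : x + x = 0 := by
  funext w; exact CharTwo.add_self_eq_zero _

lemma path_mem {F : Finset (Sym2 V)} {u v : V} (h : (gr F).Reachable u v) :
    (Pi.single u (1 : ZMod 2) + Pi.single v 1 : V → ZMod 2) ∈ sp F := by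
  refine reach_closed (P := fun x => (Pi.single u (1 : ZMod 2) + Pi.single x 1 : V → ZMod 2) ∈ sp F)
    ?_ h (by rw [zz]; exact Submodule.zero_mem _)
  intro x y hxy hx
  rw [fromEdgeSet_adj] at hxy
  have h2 : bd s(x, y) ∈ sp F := Submodule.subset_span ⟨_, hxy.1, rfl⟩
  have h3 := Submodule.add_mem _ hx h2
  rw [bd_mk hxy.2] at h3
  have e : (Pi.single u (1 : ZMod 2) + Pi.single x 1 + (Pi.single x 1 + Pi.single y 1) : V → ZMod 2)
      = Pi.single u 1 + Pi.single y 1 + (Pi.single x 1 + Pi.single x 1) := by abel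
  rw [e, zz, add_zero] at h3
  exact h3

lemma rank_ineq {G : SimpleGraph V} (hc : IsKEdgeConnected G 48) (E : Finset (Sym2 V))
    (hE : (E : Set (Sym2 V)) = G.edgeSet) (I : Finset (Sym2 V)) (hI : I ⊆ E) :
    24 * (rk E - rk I) ≤ (E \ I).card := by
  classical
  let Cp := (gr I).ConnectedComponent
  let f : V → Cp := (gr I).connectedComponentMk
  have hf : ∀ u v, f u = f v ↔ (gr I).Reachable u v := fun u v => ConnectedComponent.eq
  have fs : ∀ c : Cp, ∃ v, f v = c := fun c => by
    induction c using ConnectedComponent.ind with | _ v => exact ⟨v, rfl⟩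
  haveI : Fintype Cp := Fintype.ofSurjective f fs
  choose r hr using fs
  have hG : G.Connected := by simpa using hc ∅ (by simp)
  obtain ⟨v0⟩ := hG.nonempty
  -- rank bound
  have hrk : rk E ≤ rk I + (Fintype.card Cp - 1) := by
    let Z : Finset (V → ZMod 2) := (Finset.univ.erase (f v0)).image
      (fun c => Pi.single (r c) (1 : ZMod 2) + Pi.single (r (f v0)) 1)
    have hZ : Z.card ≤ Fintype.card Cp - 1 := by
      refine Finset.card_image_le.trans ?_
      rw [Finset.card_erase_of_mem (Finset.mem_univ _), Finset.card_univ]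
    have hZr := finrank_span_finset_le_card (R := ZMod 2) Z
    unfold Set.finrank at hZr
    have hle : sp E ≤ sp I ⊔ Submodule.span (ZMod 2) (Z : Set (V → ZMod 2)) := by
      unfold sp
      rw [Submodule.span_le]
      rintro _ ⟨e, he, rfl⟩
      induction e using Sym2.ind with | _ u v =>
      have huv : G.Adj u v := by rw [hE] at he; exact he
      rw [bd_mk huv.ne]
      have key : ∀ x, (Pi.single x (1 : ZMod 2) + Pi.single (r (f v0)) 1 : V → ZMod 2) ∈
          sp I ⊔ Submodule.span (ZMod 2) (Z : Set (V → ZMod 2)) := by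
        intro x
        have h1 : (Pi.single x (1 : ZMod 2) + Pi.single (r (f x)) 1 : V → ZMod 2) ∈ sp I :=
          path_mem ((hf _ _).1 (hr _).symm)
        by_cases hx : f x = f v0
        · rw [← hx]; exact Submodule.mem_sup_left h1
        · have h2 : (Pi.single (r (f x)) (1 : ZMod 2) + Pi.single (r (f v0)) 1 : V → ZMod 2) ∈
            Submodule.span (ZMod 2) (Z : Set (V → ZMod 2)) :=
            Submodule.subset_span (Finset.mem_coe.2
              (Finset.mem_image.2 ⟨f x, by simp [hx], rfl⟩))
          have h3 := Submodule.add_mem _ (Submodule.mem_sup_left h1) (Submodule.mem_sup_right h2)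
          have e : (Pi.single x (1 : ZMod 2) + Pi.single (r (f x)) 1 +
            (Pi.single (r (f x)) 1 + Pi.single (r (f v0)) 1) : V → ZMod 2)
            = Pi.single x 1 + Pi.single (r (f v0)) 1
              + (Pi.single (r (f x)) 1 + Pi.single (r (f x)) 1) := by abel
          rw [e, zz, add_zero] at h3
          exact h3
      have h3 := Submodule.add_mem _ (key u) (key v)
      have e : (Pi.single u (1 : ZMod 2) + Pi.single (r (f v0)) 1 +
            (Pi.single v 1 + Pi.single (r (f v0)) 1) : V → ZMod 2)
            = Pi.single u 1 + Pi.single v 1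
              + (Pi.single (r (f v0)) 1 + Pi.single (r (f v0)) 1) := by abel
      rw [e, zz, add_zero] at h3
      exact h3
    have h1 := Submodule.finrank_mono hle
    have h2 := Submodule.finrank_add_le_finrank_add_finrank (sp I)
      (Submodule.span (ZMod 2) (Z : Set (V → ZMod 2)))
    unfold rk
    omega
  by_cases hp : Fintype.card Cp ≤ 1
  · have : rk E - rk I = 0 := by omega
    simp [this]
  let dl : Cp → Finset (Sym2 V) := fun c =>
    (E \ I).filter (fun e => ∃ u v, e = s(u, v) ∧ f u = c ∧ f v ≠ c)
  have h48 : ∀ c, 48 ≤ (dl c).card := by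
    intro c
    by_contra hlt
    have hcon := hc (dl c) (by omega)
    obtain ⟨c', hc'⟩ : ∃ c', c' ≠ c := by
      by_contra hh
      push Not at hh
      exact hp (Fintype.card_le_one_iff.2 fun a b => (hh a).trans (hh b).symm)
    have := reach_closed (P := fun x => f x = c) ?_ (hcon.preconnected (r c) (r c')) (hr c)
    · rw [hr] at this; exact hc' this
    · intro x y hxy hx
      by_contra hy
      rw [deleteEdges_adj] at hxy
      have hxE : s(x, y) ∈ E := by
        rw [← Finset.mem_coe, hE]; exact hxy.1
      apply hxy.2
      simp only [dl, Finset.coe_filter, Set.mem_ofPred_eq, Finset.mem_sdiff]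
      refine ⟨⟨hxE, fun hI' => ?_⟩, x, y, rfl, hx, hy⟩
      apply hy
      rw [← hx, hf]
      exact (Adj.reachable (by rw [fromEdgeSet_adj]; exact ⟨hI', hxy.1.ne⟩)).symm
  have hsum : ∑ c : Cp, (dl c).card ≤ (E \ I).card * 2 := by
    have h1 := Finset.sum_card_bipartiteAbove_eq_sum_card_bipartiteBelow
      (s := (Finset.univ : Finset Cp)) (t := E \ I)
      (fun c e => ∃ u v, e = s(u, v) ∧ f u = c ∧ f v ≠ c)
    have h2 : ∑ c : Cp, (dl c).card = _ := h1
    rw [h2]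
    refine Finset.sum_le_card_nsmul _ _ 2 ?_
    intro e he
    induction e using Sym2.ind with | _ u v =>
    refine (Finset.card_le_card (t := {f u, f v}) ?_).trans Finset.card_le_two
    intro c
    simp only [Finset.bipartiteBelow, Finset.mem_filter, Finset.mem_univ, true_and,
      Finset.mem_insert, Finset.mem_singleton]
    rintro ⟨a, b, hab, h, -⟩
    rw [Sym2.eq_iff] at hab
    rcases hab with ⟨rfl, rfl⟩ | ⟨rfl, rfl⟩
    · left; exact h.symm
    · right; exact h.symm
  have hs2 : Fintype.card Cp * 48 ≤ ∑ c : Cp, (dl c).card := by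
    have := Finset.card_nsmul_le_sum (Finset.univ : Finset Cp) (fun c => (dl c).card) 48
      (fun c _ => h48 c)
    simpa using this
  omega

lemma spn_conn {E C : Finset (Sym2 V)} (hL : ∀ e ∈ E, ¬ e.IsDiag) (hE : Conn E) (hC : C ⊆ E) (h : rk C = rk E) : Conn C := by
  classical
  have hs : sp C = sp E := Submodule.eq_of_le_of_finrank_eq (sp_mono hC) h
  intro u v
  let R : Finset V := Finset.univ.filter (fun x => (gr C).Reachable u x)
  let φ : (V → ZMod 2) →ₗ[ZMod 2] ZMod 2 := ∑ w ∈ R, LinearMap.proj w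
  have hφ : ∀ x, φ (Pi.single x 1) = if x ∈ R then 1 else 0 := by
    intro x
    simp [φ, Finset.sum_pi_single]
  have hk : sp C ≤ LinearMap.ker φ := by
    unfold sp
    rw [Submodule.span_le]
    rintro _ ⟨e, he, rfl⟩
    induction e using Sym2.ind with | _ x y =>
    simp only [SetLike.mem_coe, LinearMap.mem_ker]
    by_cases hxy : x = y
    · exact absurd hxy (hL _ (hC he))
    · rw [bd_mk hxy, map_add, hφ, hφ]
      have ha : (gr C).Adj x y := by rw [fromEdgeSet_adj]; exact ⟨he, hxy⟩
      have : x ∈ R ↔ y ∈ R := by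
        simp only [R, Finset.mem_filter, Finset.mem_univ, true_and]
        exact ⟨fun h => h.trans ha.reachable, fun h => h.trans ha.symm.reachable⟩
      by_cases hx : x ∈ R
      · rw [if_pos hx, if_pos (this.1 hx)]; rfl
      · rw [if_neg hx, if_neg (fun h => hx (this.2 h))]; rfl
  have h1 := hk (hs ▸ path_mem (hE u v))
  rw [LinearMap.mem_ker, map_add, hφ, hφ, if_pos (by simp [R])] at h1
  by_contra hv
  rw [if_neg (by simpa [R] using hv)] at h1
  exact absurd h1 (by decide)

lemma conn_dg {C : Finset (Sym2 V)} [Nontrivial V] (hC : Conn C) (v : V) : 1 ≤ dg C v := by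
  obtain ⟨u, hu⟩ := exists_ne v
  obtain ⟨p⟩ := hC v u
  cases p with
  | nil => exact absurd rfl hu
  | cons h _ =>
    rw [fromEdgeSet_adj] at h
    exact Finset.card_pos.2 ⟨_, Finset.mem_filter.2 ⟨h.1, Sym2.mem_mk_left _ _⟩⟩

lemma sum_bd (F : Finset (Sym2 V)) (v : V) : (∑ e ∈ F, bd e) v = (dg F v : ZMod 2) := by
  simp [bd, dg, Finset.sum_apply, Finset.sum_boole]

lemma conn_parity {C : Finset (Sym2 V)} (hC : Conn C) (t : V → ZMod 2) (ht : ∑ v, t v = 0) :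
    ∃ J, J ⊆ C ∧ ∀ v, (dg J v : ZMod 2) = t v := by
  classical
  have hmem : t ∈ sp C := by
    by_cases hV : Nonempty V
    · obtain ⟨v0⟩ := hV
      have : t = ∑ v, t v • (Pi.single v (1 : ZMod 2) + Pi.single v0 1 : V → ZMod 2) := by
        simp only [smul_add, Finset.sum_add_distrib, ← Finset.sum_smul, ht, zero_smul, add_zero]
        funext w
        simp [Finset.sum_apply, Pi.single_apply]
      rw [this]
      exact Submodule.sum_mem _ fun v _ => Submodule.smul_mem _ _ (path_mem (hC v v0))
    · have : t = 0 := by funext w; exact absurd ⟨w⟩ hV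
      rw [this]; exact Submodule.zero_mem _
  unfold sp at hmem
  rw [Submodule.mem_span_image_finset_iff_exists_fun'] at hmem
  obtain ⟨c, hc⟩ := hmem
  refine ⟨C.filter (fun e => c e = 1), Finset.filter_subset _ _, fun v => ?_⟩
  rw [← sum_bd, ← hc, Finset.sum_filter]
  have h3 : ∀ e ∈ C, (if c e = 1 then bd e else 0) = c e • bd e := by
    intro e _
    have : ∀ x : ZMod 2, x = 0 ∨ x = 1 := by decide
    rcases this (c e) with h | h <;> simp [h]
  rw [Finset.sum_congr rfl h3]

end P5

namespace P5

variable {V : Type} [Fintype V] [DecidableEq V]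

def Bip (σ : V → Bool) (E : Finset (Sym2 V)) : Prop :=
  ∀ e ∈ E, ∃ a b, σ a = true ∧ σ b = false ∧ e = s(a, b)

lemma Bip.mono {σ : V → Bool} {E F : Finset (Sym2 V)} (h : Bip σ E) (hF : F ⊆ E) : Bip σ F :=
  fun e he => h e (hF he)

lemma Bip.neg {σ : V → Bool} {E : Finset (Sym2 V)} (h : Bip σ E) : Bip (fun v => !σ v) E := by
  intro e he
  obtain ⟨a, b, ha, hb, h⟩ := h e he
  exact ⟨b, a, by simp [hb], by simp [ha], by rw [h, Sym2.eq_swap]⟩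

lemma Bip.loopless {σ : V → Bool} {E : Finset (Sym2 V)} (h : Bip σ E) :
    ∀ e ∈ E, ¬ e.IsDiag := by
  intro e he
  obtain ⟨a, b, ha, hb, h⟩ := h e he
  subst h
  rw [Sym2.mk_isDiag_iff]
  rintro rfl
  simp [ha] at hb

lemma Bip.al {σ : V → Bool} {E : Finset (Sym2 V)} (h : Bip σ E) :
    ∃ al : Sym2 V → V, ∀ e ∈ E, ∀ a, al e = a ↔ (a ∈ e ∧ σ a = true) := by
  classical
  refine ⟨fun e => if h : ∃ a ∈ e, σ a = true then h.choose else e.out.1, fun e he a => ?_⟩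
  obtain ⟨a', b', ha, hb, rfl⟩ := h e he
  have hex : ∃ a ∈ s(a', b'), σ a = true := ⟨a', by simp, ha⟩
  simp only [hex, dite_true]
  have hs := hex.choose_spec
  have hu : ∀ x, x ∈ s(a', b') ∧ σ x = true → x = a' := by
    rintro x ⟨hx, hx2⟩
    rcases Sym2.mem_iff.1 hx with h | h
    · exact h
    · subst h; simp [hb] at hx2
  constructor
  · rintro rfl; exact hs
  · intro h; rw [hu _ hs, hu _ h]

lemma dg_mono {F F' : Finset (Sym2 V)} (h : F ⊆ F') (v : V) : dg F v ≤ dg F' v :=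
  Finset.card_le_card (Finset.filter_subset_filter _ h)

lemma dg_union {F F' : Finset (Sym2 V)} (h : Disjoint F F') (v : V) :
    dg (F ∪ F') v = dg F v + dg F' v := by
  unfold dg
  rw [Finset.filter_union, Finset.card_union_of_disjoint]
  exact Finset.disjoint_filter_filter h

lemma dg_union_le (F F' : Finset (Sym2 V)) (v : V) :
    dg (F ∪ F') v ≤ dg F v + dg F' v := by
  unfold dg
  rw [Finset.filter_union]
  exact Finset.card_union_le _ _

lemma dg_sdiff {F F' : Finset (Sym2 V)} (h : F' ⊆ F) (v : V) :
    dg (F \ F') v + dg F' v = dg F v := by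
  rw [← dg_union (Finset.sdiff_disjoint), Finset.sdiff_union_of_subset h]

lemma bip_sum {σ : V → Bool} {F : Finset (Sym2 V)} (h : Bip σ F) :
    ∑ v with σ v = true, dg F v = F.card := by
  have h1 := Finset.sum_card_bipartiteAbove_eq_sum_card_bipartiteBelow
      (s := (Finset.univ.filter (fun v => σ v = true))) (t := F) (fun v e => v ∈ e)
  have h2 : ∑ v with σ v = true, dg F v = _ := h1
  rw [h2, Finset.card_eq_sum_ones]
  refine Finset.sum_congr rfl fun e he => ?_
  obtain ⟨a, b, ha, hb, rfl⟩ := h e he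
  rw [Finset.card_eq_one]
  refine ⟨a, ?_⟩
  ext x
  simp only [Finset.bipartiteBelow, Finset.mem_filter, Finset.mem_univ, true_and,
    Finset.mem_singleton, Sym2.mem_iff]
  constructor
  · rintro ⟨hx, rfl | rfl⟩
    · rfl
    · simp [hb] at hx
  · rintro rfl; exact ⟨ha, Or.inl rfl⟩

lemma bip_sum_false {σ : V → Bool} {F : Finset (Sym2 V)} (h : Bip σ F) :
    ∑ v with σ v = false, dg F v = F.card := by
  have := bip_sum h.neg
  simpa using this

lemma sum_split (σ : V → Bool) {M : Type*} [AddCommMonoid M] (f : V → M) :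
    ∑ v, f v = ∑ v with σ v = true, f v + ∑ v with σ v = false, f v := by
  rw [← Finset.sum_filter_add_sum_filter_not Finset.univ (fun v => σ v = true)]
  simp

lemma handshake {σ : V → Bool} {F : Finset (Sym2 V)} (h : Bip σ F) :
    ∑ v, dg F v = 2 * F.card := by
  rw [sum_split σ, bip_sum h, bip_sum_false h]; ring

lemma Conn.mono {F F' : Finset (Sym2 V)} (h : Conn F) (hs : F ⊆ F') : Conn F' :=
  fun u v => (h u v).mono (fromEdgeSet_mono (by exact_mod_cast hs))

lemma even_cast {n : ℕ} : ((n : ℕ) : ZMod 2) = 0 ↔ 2 ∣ n := ZMod.natCast_eq_zero_iff n 2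

lemma cast_mod {n m : ℕ} : ((n : ℕ) : ZMod 2) = (m : ZMod 2) ↔ n % 2 = m % 2 :=
  ZMod.natCast_eq_natCast_iff' n m 2

lemma mk_even {σ : V → Bool} {C C' : Finset (Sym2 V)} (hb : Bip σ C) (hC' : Conn C')
    (hd : Disjoint C C') : ∃ H, C ⊆ H ∧ H ⊆ C ∪ C' ∧ ∀ v, 2 ∣ dg H v := by
  obtain ⟨J, hJ, hJv⟩ := conn_parity hC' (fun v => (dg C v : ZMod 2)) (by
    rw [← Nat.cast_sum, handshake hb, even_cast]; exact dvd_mul_right _ _)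
  refine ⟨C ∪ J, Finset.subset_union_left, Finset.union_subset_union_right hJ, fun v => ?_⟩
  rw [dg_union (hd.mono_right hJ), ← even_cast, Nat.cast_add, hJv]
  exact CharTwo.add_self_eq_zero _

lemma trees24 {G : SimpleGraph V} (hc : IsKEdgeConnected G 48) (E : Finset (Sym2 V))
    (hE : (E : Set (Sym2 V)) = G.edgeSet) :
    ∃ T : Fin 24 → Finset (Sym2 V), (∀ j, T j ⊆ E) ∧ (∀ i j, i ≠ j → Disjoint (T i) (T j)) ∧
      (∀ j, rk (T j) = rk E) := by
  obtain ⟨C, h1, h2, h3, -⟩ := bunch (fun e => e.out.1) E 1 24 one_pos (by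
    intro I hI; have := rank_ineq hc E hE I hI; omega)
  exact ⟨C, h1, h2, h3⟩

lemma bunch2 {σ : V → Bool} {E : Finset (Sym2 V)} (hb : Bip σ E) (hE : Conn E) [Nontrivial V]
    (T : Fin 24 → Finset (Sym2 V)) (hT : ∀ j, T j ⊆ E)
    (hd : ∀ i j, i ≠ j → Disjoint (T i) (T j)) (hr : ∀ j, rk (T j) = rk E)
    (J : Finset (Fin 24)) (g N : ℕ) (hg : 0 < g) (hN : 0 < N) (hJ : J.card = g * N) :
    ∃ C : Fin N → Finset (Sym2 V), (∀ j, C j ⊆ J.biUnion T) ∧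
      (∀ i j, i ≠ j → Disjoint (C i) (C j)) ∧ (∀ j, Conn (C j)) ∧
      (∀ a, g * N ≤ dg (J.biUnion T) a) ∧
      ∀ a, σ a = true → ∑ j, dg (C j) a ≤ (dg (J.biUnion T) a + g - 1) / g := by
  obtain ⟨al, hal⟩ := hb.al
  have hUE : J.biUnion T ⊆ E := Finset.biUnion_subset.2 fun j _ => hT j
  have hJne : J.Nonempty := by rw [← Finset.card_pos, hJ]; positivity
  have hrU : rk (J.biUnion T) = rk E := by
    apply le_antisymm (rk_mono hUE)
    obtain ⟨j, hj⟩ := hJne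
    rw [← hr j]
    exact rk_mono (Finset.subset_biUnion_of_mem T hj)
  have hdj : (J : Set (Fin 24)).PairwiseDisjoint T := fun i _ j _ hij => hd i j hij
  obtain ⟨C, h1, h2, h3, h4⟩ := bunch al (J.biUnion T) g N hg (by
    intro I hI
    have e1 : (J.biUnion T \ I).card = ∑ j ∈ J, (T j \ I).card := by
      rw [← Finset.card_biUnion]
      · congr 1
        ext e
        simp only [Finset.mem_sdiff, Finset.mem_biUnion]
        constructor
        · rintro ⟨⟨j, hj, he⟩, h⟩; exact ⟨j, hj, he, h⟩
        · rintro ⟨j, hj, he, h⟩; exact ⟨⟨j, hj, he⟩, h⟩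
      · intro i _ j _ hij
        exact (hd i j hij).mono Finset.sdiff_subset Finset.sdiff_subset
    rw [e1, ← mul_assoc, ← hJ, ← smul_eq_mul]
    refine Finset.card_nsmul_le_sum _ _ _ fun j _ => ?_
    have := rk_le_add (T j) I
    rw [hr] at this
    rw [hrU]
    omega)
  have hconn : ∀ F, F ⊆ E → rk F = rk E → Conn F := fun F hF h => spn_conn hb.loopless hE hF h
  have hcf : ∀ F, F ⊆ E → ∀ a, σ a = true → (F.filter (fun e => al e = a)).card = dg F a := by
    intro F hF a ha
    unfold dg
    congr 1
    refine Finset.filter_congr fun e he => ?_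
    rw [hal e (hF he)]
    exact ⟨fun h => h.1, fun h => ⟨h, ha⟩⟩
  refine ⟨C, h1, h2, fun j => hconn _ ((h1 j).trans hUE) (by rw [h3, hrU]), ?_, ?_⟩
  · intro a
    have : dg (J.biUnion T) a = ∑ j ∈ J, dg (T j) a := by
      unfold dg
      rw [Finset.filter_biUnion, Finset.card_biUnion]
      intro i _ j _ hij
      exact Finset.disjoint_filter_filter (hd i j hij)
    rw [this, ← hJ]
    have := Finset.card_nsmul_le_sum J (fun j => dg (T j) a) 1
      (fun j _ => conn_dg (hconn _ (hT j) (hr j)) a)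
    simpa using this
  · intro a ha
    have := h4 a
    rw [hcf _ hUE a ha] at this
    refine le_trans (le_of_eq (Finset.sum_congr rfl fun j _ => ?_)) this
    rw [hcf _ ((h1 j).trans hUE) a ha]

lemma fill {σ : V → Bool} {P : Finset (Sym2 V)} (hb : Bip σ P) (n : V → ℕ)
    (hn : ∀ a, σ a = true → n a ≤ dg P a) :
    ∃ Q, Q ⊆ P ∧ ∀ a, σ a = true → dg Q a = n a := by
  classical
  have : ∀ a, ∃ q, q ⊆ P.filter (fun e => a ∈ e) ∧ (σ a = true → q.card = n a) := by
    intro a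
    by_cases ha : σ a = true
    · obtain ⟨q, h1, h2⟩ := Finset.exists_subset_card_eq (hn a ha)
      exact ⟨q, h1, fun _ => h2⟩
    · exact ⟨∅, by simp, fun h => absurd h ha⟩
  choose q hq1 hq2 using this
  refine ⟨(Finset.univ.filter (fun a => σ a = true)).biUnion q, ?_, ?_⟩
  · refine Finset.biUnion_subset.2 fun a _ => (hq1 a).trans (Finset.filter_subset _ _)
  · intro a ha
    rw [← hq2 a ha]
    unfold dg
    congr 1
    ext e
    simp only [Finset.mem_filter, Finset.mem_biUnion, Finset.mem_univ, true_and]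
    constructor
    · rintro ⟨⟨a', ha', he⟩, hae⟩
      have h1 := Finset.mem_filter.1 (hq1 a' he)
      obtain ⟨x, y, hx, hy, rfl⟩ := hb e h1.1
      have h2 := h1.2
      rw [Sym2.mem_iff] at h2 hae
      have e1 : a = x := by
        rcases hae with h | h
        · exact h
        · subst h; simp [hy] at ha
      have e2 : a' = x := by
        rcases h2 with h | h
        · exact h
        · subst h; simp [hy] at ha'
      subst e1; subst e2; exact he
    · intro he
      exact ⟨⟨a, ha, he⟩, (Finset.mem_filter.1 (hq1 a he)).2⟩

lemma exists_k (d p1 p2 p3 f s1 s2 s3 s4 : ℕ) (h1 : 6 ≤ s1) (h2 : 4 ≤ s2) (h3 : 4 ≤ s3)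
    (h4 : 9 ≤ s4) (g1 : 2 * p1 ≤ (s1 + 3 - 1) / 3) (g2 : 2 * p2 ≤ (s2 + 2 - 1) / 2)
    (g3 : 2 * p3 ≤ (s3 + 2 - 1) / 2) (g4 : f ≤ (s4 + 3 - 1) / 3) :
    ∃ k, 2 ≤ k ∧ p1 ≤ k ∧ p2 + f ≤ 2 * k ∧ p3 ≤ 2 * k ∧ k % 2 = d % 2 ∧
      5 * k + p1 + p2 + p3 ≤ s1 + s2 + s3 + s4 := by
  let m := max (max 2 p1) (max ((p2 + f + 1) / 2) ((p3 + 1) / 2))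
  have hm : m = max (max 2 p1) (max ((p2 + f + 1) / 2) ((p3 + 1) / 2)) := rfl
  by_cases hd : m % 2 = d % 2
  · exact ⟨m, by omega, by omega, by omega, by omega, hd, by omega⟩
  · exact ⟨m + 1, by omega, by omega, by omega, by omega, by omega, by omega⟩

structure Setup (σ : V → Bool) (E : Finset (Sym2 V)) where
  (T0 H1 H2 H3 P1 P2 P3 : Finset (Sym2 V))
  (k : V → ℕ)
  hT0 : T0 ⊆ E
  hH1 : H1 ⊆ E
  hH2 : H2 ⊆ E
  hH3 : H3 ⊆ E
  hP1 : P1 ⊆ E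
  hP2 : P2 ⊆ E
  hP3 : P3 ⊆ E
  dis : [T0, H1, H2, H3, P1, P2, P3].Pairwise Disjoint
  cT0 : Conn T0
  cH1 : Conn H1
  cH2 : Conn H2
  cH3 : Conn H3
  eH1 : ∀ v, 2 ∣ dg H1 v
  eH2 : ∀ v, 2 ∣ dg H2 v
  eH3 : ∀ v, 2 ∣ dg H3 v
  three : ∀ v, 3 ≤ dg P2 v
  d1 : ∀ a, σ a = true → dg H1 a / 2 + dg P1 a = k a
  d2 : ∀ a, σ a = true → dg H2 a / 2 + dg P2 a = 2 * k a
  d3 : ∀ a, σ a = true → dg H3 a / 2 + dg P3 a = 2 * k a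
  k2 : ∀ a, σ a = true → 2 ≤ k a
  kd : ∀ a, σ a = true → k a % 2 = dg E a % 2

lemma setup {σ : V → Bool} {G : SimpleGraph V} (hc : IsKEdgeConnected G 48) (E : Finset (Sym2 V))
    (hE : (E : Set (Sym2 V)) = G.edgeSet) (hb : Bip σ E) [Nontrivial V] :
    Nonempty (Setup σ E) := by
  classical
  have hG : G.Connected := by simpa using hc ∅ (by simp)
  have hcE : Conn E := by
    intro u v
    have : gr E = G := by unfold gr; rw [hE, fromEdgeSet_edgeSet]
    rw [this]; exact hG.preconnected u v
  obtain ⟨T, hT, hd, hr⟩ := trees24 hc E hE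
  let J1 : Finset (Fin 24) := {0, 1, 2, 3, 4, 5}
  let J2 : Finset (Fin 24) := {6, 7, 8, 9}
  let J3 : Finset (Fin 24) := {10, 11, 12, 13}
  let J4 : Finset (Fin 24) := {14, 15, 16, 17, 18, 19, 20, 21, 22}
  let J0 : Finset (Fin 24) := {23}
  have hdj : ∀ I J : Finset (Fin 24), Disjoint I J → Disjoint (I.biUnion T) (J.biUnion T) := by
    intro I J h
    rw [Finset.disjoint_biUnion_left]
    intro i hi
    rw [Finset.disjoint_biUnion_right]
    intro j hj
    exact hd i j (by rintro rfl; exact Finset.disjoint_left.1 h hi hj)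
  obtain ⟨C1, a1, b1, c1, d1, e1⟩ := bunch2 hb hcE T hT hd hr J1 3 2 (by norm_num) (by norm_num) rfl
  obtain ⟨C2, a2, b2, c2, d2, e2⟩ := bunch2 hb hcE T hT hd hr J2 2 2 (by norm_num) (by norm_num) rfl
  obtain ⟨C3, a3, b3, c3, d3, e3⟩ := bunch2 hb hcE T hT hd hr J3 2 2 (by norm_num) (by norm_num) rfl
  obtain ⟨C4, a4, b4, c4, d4, e4⟩ := bunch2 hb hcE T hT hd hr J4 3 3 (by norm_num) (by norm_num) rfl
  obtain ⟨C0, a0, b0, c0, d0, e0⟩ := bunch2 hb hcE T hT hd hr J0 1 1 (by norm_num) (by norm_num) rfl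
  set U1 := J1.biUnion T with hU1
  set U2 := J2.biUnion T with hU2
  set U3 := J3.biUnion T with hU3
  set U4 := J4.biUnion T with hU4
  set U0 := J0.biUnion T with hU0
  have hUE : ∀ J : Finset (Fin 24), J.biUnion T ⊆ E := fun J => Finset.biUnion_subset.2 fun j _ => hT j
  have u01 : Disjoint U0 U1 := hdj _ _ (by decide)
  have u02 : Disjoint U0 U2 := hdj _ _ (by decide)
  have u03 : Disjoint U0 U3 := hdj _ _ (by decide)
  have u04 : Disjoint U0 U4 := hdj _ _ (by decide)
  have u12 : Disjoint U1 U2 := hdj _ _ (by decide)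
  have u13 : Disjoint U1 U3 := hdj _ _ (by decide)
  have u14 : Disjoint U1 U4 := hdj _ _ (by decide)
  have u23 : Disjoint U2 U3 := hdj _ _ (by decide)
  have u24 : Disjoint U2 U4 := hdj _ _ (by decide)
  have u34 : Disjoint U3 U4 := hdj _ _ (by decide)
  have mkH : ∀ (U : Finset (Sym2 V)) (C : Fin 2 → Finset (Sym2 V)), U ⊆ E → (∀ j, C j ⊆ U) →
      (∀ i j, i ≠ j → Disjoint (C i) (C j)) → (∀ j, Conn (C j)) →
      ∃ H, H ⊆ U ∧ Conn H ∧ (∀ v, 2 ∣ dg H v) ∧ ∀ v, dg H v ≤ ∑ j, dg (C j) v := by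
    intro U C hU hC hdis hcon
    obtain ⟨H, h1, h2, h3⟩ := mk_even (hb.mono ((hC 0).trans hU)) (hcon 1) (hdis 0 1 (by decide))
    refine ⟨H, h2.trans (Finset.union_subset (hC 0) (hC 1)), (hcon 0).mono h1, h3, fun v => ?_⟩
    rw [Fin.sum_univ_two, ← dg_union (hdis 0 1 (by decide))]
    exact dg_mono h2 v
  obtain ⟨H1, hH1, cH1, eH1, lH1⟩ := mkH U1 C1 (hUE _) a1 b1 c1
  obtain ⟨H2, hH2, cH2, eH2, lH2⟩ := mkH U2 C2 (hUE _) a2 b2 c2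
  obtain ⟨H3, hH3, cH3, eH3, lH3⟩ := mkH U3 C3 (hUE _) a3 b3 c3
  let F := C4 0 ∪ C4 1 ∪ C4 2
  have dF : ∀ v, dg F v = ∑ j, dg (C4 j) v := by
    intro v
    rw [Fin.sum_univ_three, ← dg_union (b4 0 1 (by decide)), ← dg_union]
    rw [Finset.disjoint_union_left]
    exact ⟨b4 0 2 (by decide), b4 1 2 (by decide)⟩
  have hF : F ⊆ U4 := Finset.union_subset (Finset.union_subset (a4 0) (a4 1)) (a4 2)
  have F3 : ∀ v, 3 ≤ dg F v := by
    intro v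
    rw [dF, Fin.sum_univ_three]
    have := conn_dg (c4 0) v
    have := conn_dg (c4 1) v
    have := conn_dg (c4 2) v
    omega
  have hk : ∀ a, ∃ k, σ a = true → 2 ≤ k ∧ dg H1 a / 2 ≤ k ∧ dg H2 a / 2 + dg F a ≤ 2 * k ∧
      dg H3 a / 2 ≤ 2 * k ∧ k % 2 = dg E a % 2 ∧
      5 * k + dg H1 a / 2 + dg H2 a / 2 + dg H3 a / 2 ≤ dg U1 a + dg U2 a + dg U3 a + dg U4 a := by
    intro a
    by_cases ha : σ a = true
    · have q1 := lH1 a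
      have q2 := lH2 a
      have q3 := lH3 a
      have q4 := dF a
      have r1 := e1 a ha
      have r2 := e2 a ha
      have r3 := e3 a ha
      have r4 := e4 a ha
      obtain ⟨k, hk⟩ := exists_k (dg E a) (dg H1 a / 2) (dg H2 a / 2) (dg H3 a / 2) (dg F a)
        (dg U1 a) (dg U2 a) (dg U3 a) (dg U4 a) (d1 a) (d2 a) (d3 a) (d4 a)
        (by omega) (by omega) (by omega) (by omega)
      exact ⟨k, fun _ => hk⟩
    · exact ⟨0, fun h => absurd h ha⟩
  choose k hk using hk
  let T0 := C0 0
  have hT0 : T0 ⊆ U0 := a0 0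
  let R := T0 ∪ H1 ∪ H2 ∪ H3 ∪ F
  have hRE : R ⊆ E := Finset.union_subset (Finset.union_subset (Finset.union_subset
    (Finset.union_subset (hT0.trans (hUE _)) (hH1.trans (hUE _))) (hH2.trans (hUE _)))
    (hH3.trans (hUE _))) (hF.trans (hUE _))
  have hP : ∀ a, dg (E \ R) a + (dg T0 a + dg H1 a + dg H2 a + dg H3 a + dg F a) ≥ dg E a := by
    intro a
    have h0 := dg_sdiff hRE a
    have h1 : dg R a ≤ _ := dg_union_le (T0 ∪ H1 ∪ H2 ∪ H3) F a
    have h2 := dg_union_le (T0 ∪ H1 ∪ H2) H3 a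
    have h3 := dg_union_le (T0 ∪ H1) H2 a
    have h4 := dg_union_le T0 H1 a
    omega
  have hU : ∀ a, dg U0 a + dg U1 a + dg U2 a + dg U3 a + dg U4 a ≤ dg E a := by
    intro a
    rw [← dg_union u01, ← dg_union, ← dg_union, ← dg_union]
    · refine dg_mono ?_ a
      exact Finset.union_subset (Finset.union_subset (Finset.union_subset
        (Finset.union_subset (hUE _) (hUE _)) (hUE _)) (hUE _)) (hUE _)
    · simp only [Finset.disjoint_union_left]; exact ⟨⟨⟨u04, u14⟩, u24⟩, u34⟩
    · simp only [Finset.disjoint_union_left]; exact ⟨⟨u03, u13⟩, u23⟩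
    · simp only [Finset.disjoint_union_left]; exact ⟨u02, u12⟩
  have bE : ∀ F', F' ⊆ E → Bip σ F' := fun F' h => hb.mono h
  have l0 : ∀ a, dg T0 a ≤ dg U0 a := fun a => dg_mono hT0 a
  obtain ⟨Q1, hQ1, dQ1⟩ := fill (bE (E \ R) Finset.sdiff_subset) (fun a => k a - dg H1 a / 2) (by
    intro a ha
    have := hk a ha
    have := hP a
    have := hU a
    have := l0 a
    have := eH1 a
    have := eH2 a
    have := eH3 a
    omega)
  obtain ⟨Q2, hQ2, dQ2⟩ := fill (bE ((E \ R) \ Q1) (Finset.sdiff_subset.trans Finset.sdiff_subset))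
    (fun a => 2 * k a - dg H2 a / 2 - dg F a) (by
    intro a ha
    have := hk a ha
    have := hP a
    have := hU a
    have := l0 a
    have := eH1 a
    have := eH2 a
    have := eH3 a
    have := dQ1 a ha
    have := dg_sdiff hQ1 a
    omega)
  obtain ⟨Q3, hQ3, dQ3⟩ := fill (bE (((E \ R) \ Q1) \ Q2)
    ((Finset.sdiff_subset.trans Finset.sdiff_subset).trans Finset.sdiff_subset))
    (fun a => 2 * k a - dg H3 a / 2) (by
    intro a ha
    have := hk a ha
    have := hP a
    have := hU a
    have := l0 a
    have := eH1 a
    have := eH2 a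
    have := eH3 a
    have := dQ1 a ha
    have := dQ2 a ha
    have := dg_sdiff hQ1 a
    have := dg_sdiff hQ2 a
    omega)
  have x1 : Disjoint (E \ R) R := Finset.sdiff_disjoint
  have x2 : Disjoint ((E \ R) \ Q1) Q1 := Finset.sdiff_disjoint
  have x3 : Disjoint (((E \ R) \ Q1) \ Q2) Q2 := Finset.sdiff_disjoint
  have y1 : Disjoint Q1 R := x1.mono_left hQ1
  have y2 : Disjoint Q2 R := x1.mono_left (hQ2.trans Finset.sdiff_subset)
  have y3 : Disjoint Q3 R := x1.mono_left
    ((hQ3.trans Finset.sdiff_subset).trans Finset.sdiff_subset)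
  have z12 : Disjoint Q2 Q1 := x2.mono_left hQ2
  have z13 : Disjoint Q3 Q1 := x2.mono_left (hQ3.trans Finset.sdiff_subset)
  have z23 : Disjoint Q3 Q2 := x3.mono_left hQ3
  simp only [R, Finset.disjoint_union_right] at y1 y2 y3
  obtain ⟨⟨⟨⟨y10, y11⟩, y12⟩, y13⟩, y14⟩ := y1
  obtain ⟨⟨⟨⟨y20, y21⟩, y22⟩, y23⟩, y24⟩ := y2
  obtain ⟨⟨⟨⟨y30, y31⟩, y32⟩, y33⟩, y34⟩ := y3
  refine ⟨⟨T0, H1, H2, H3, Q1, Q2 ∪ F, Q3, k, hT0.trans (hUE _), hH1.trans (hUE _),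
    hH2.trans (hUE _), hH3.trans (hUE _), hQ1.trans Finset.sdiff_subset,
    Finset.union_subset ((hQ2.trans Finset.sdiff_subset).trans Finset.sdiff_subset)
      (hF.trans (hUE _)),
    ((hQ3.trans Finset.sdiff_subset).trans Finset.sdiff_subset).trans Finset.sdiff_subset,
    ?_, c0 0, cH1, cH2, cH3, eH1, eH2, eH3, ?_, ?_, ?_, ?_, fun a ha => (hk a ha).1,
    fun a ha => (hk a ha).2.2.2.2.1⟩⟩
  · simp only [List.pairwise_cons, List.mem_cons, forall_eq_or_imp, List.not_mem_nil,
      Finset.disjoint_union_left, Finset.disjoint_union_right]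
    refine ⟨⟨u01.mono hT0 hH1, u02.mono hT0 hH2, u03.mono hT0 hH3, y10.symm,
      ⟨y20.symm, u04.mono hT0 hF⟩, y30.symm, by simp⟩,
      ⟨u12.mono hH1 hH2, u13.mono hH1 hH3, y11.symm, ⟨y21.symm, u14.mono hH1 hF⟩, y31.symm, by simp⟩,
      ⟨u23.mono hH2 hH3, y12.symm, ⟨y22.symm, u24.mono hH2 hF⟩, y32.symm, by simp⟩,
      ⟨y13.symm, ⟨y23.symm, u34.mono hH3 hF⟩, y33.symm, by simp⟩,
      ⟨⟨z12.symm, y14⟩, z13.symm, by simp⟩, ⟨⟨z23.symm, y34.symm⟩, by simp⟩, by simp⟩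
  · intro v; exact (F3 v).trans (dg_mono Finset.subset_union_right v)
  · intro a ha
    have := hk a ha
    rw [dQ1 a ha]; omega
  · intro a ha
    have := hk a ha
    rw [dg_union y24, dQ2 a ha]; omega
  · intro a ha
    have := hk a ha
    rw [dQ3 a ha]; omega

end P5

namespace P5

variable {V : Type} [Fintype V] [DecidableEq V]

lemma edges_eq_map {H : SimpleGraph V} {u v : V} (p : H.Walk u v) :
    p.edges = (List.range p.length).map (fun i => s(p.getVert i, p.getVert (i + 1))) := by
  induction p with
  | nil => simp
  | cons h q ih =>
    rw [Walk.edges_cons, ih, Walk.length_cons, List.range_succ_eq_map, List.map_cons, List.map_map]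
    simp [Function.comp_def]

lemma trail_len {F : Finset (Sym2 V)} {u v : V} (p : (gr F).Walk u v) (h : p.IsTrail) :
    p.length ≤ F.card := by
  rw [← Walk.length_edges, ← List.toFinset_card_of_nodup h.edges_nodup]
  refine Finset.card_le_card fun e he => ?_
  have := p.edges_subset_edgeSet (List.mem_toFinset.1 he)
  rw [edgeSet_fromEdgeSet] at this
  exact this.1

lemma gr_edges {F : Finset (Sym2 V)} {u v : V} (p : (gr F).Walk u v) {e} (he : e ∈ p.edges) :
    e ∈ F := by
  have := p.edges_subset_edgeSet he
  rw [edgeSet_fromEdgeSet] at this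
  exact this.1

lemma countP_eq {l : List (Sym2 V)} (h : l.Nodup) (v : V) :
    l.countP (fun e => v ∈ e) = dg l.toFinset v := by
  unfold dg
  rw [List.countP_eq_length_filter, ← List.toFinset_card_of_nodup (h.filter _)]
  congr 1
  ext e
  simp

/-- longest trail from `v` is closed -/
lemma euler0 (F : Finset (Sym2 V)) (hl : ∀ e ∈ F, ¬ e.IsDiag) (he : ∀ v, 2 ∣ dg F v) (v : V) :
    ∃ c : (gr F).Walk v v, c.IsTrail ∧ ∀ e ∈ F, v ∈ e → e ∈ c.edges := by
  classical
  let P : ℕ → Prop := fun n => ∃ u, ∃ p : (gr F).Walk v u, p.IsTrail ∧ p.length = n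
  have hP0 : P 0 := ⟨v, Walk.nil, Walk.IsTrail.nil, rfl⟩
  let n := Nat.findGreatest P F.card
  have hPn : P n := Nat.findGreatest_spec (Nat.zero_le _) hP0
  have hmax : ∀ u, ∀ p : (gr F).Walk v u, p.IsTrail → p.length ≤ n := fun u p hp =>
    Nat.le_findGreatest (trail_len p hp) ⟨u, p, hp, rfl⟩
  obtain ⟨u, p, hp, hlen⟩ := hPn
  have hall : ∀ e ∈ F, u ∈ e → e ∈ p.edges := by
    intro e heF hue
    by_contra hne
    obtain ⟨y, rfl⟩ := Sym2.mem_iff_exists.1 hue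
    have hadj : (gr F).Adj u y := by
      rw [fromEdgeSet_adj]
      exact ⟨heF, fun h => hl _ heF (by simp [h])⟩
    have ht : (p.concat hadj).IsTrail := by
      rw [Walk.isTrail_def, Walk.edges_concat, List.concat_eq_append, List.nodup_append]
      refine ⟨hp.edges_nodup, by simp, ?_⟩
      intro a ha b hb
      simp only [List.mem_singleton] at hb
      subst hb
      rintro rfl
      exact hne ha
    have := hmax _ _ ht
    rw [Walk.length_concat] at this
    omega
  have huv : v = u := by
    by_contra hne
    have h1 := hp.even_countP_edges_iff u
    have h2 : p.edges.countP (fun e => u ∈ e) = dg F u := by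
      rw [countP_eq hp.edges_nodup]
      unfold dg
      congr 1
      ext e
      simp only [Finset.mem_filter, List.mem_toFinset]
      exact ⟨fun h => ⟨gr_edges p h.1, h.2⟩, fun h => ⟨hall e h.1 h.2, h.2⟩⟩
    rw [h2] at h1
    exact (h1.1 (even_iff_two_dvd.2 (he u)) hne).2 rfl
  subst huv
  exact ⟨p, hp, hall⟩

lemma euler1w (F : Finset (Sym2 V)) (hl : ∀ e ∈ F, ¬ e.IsDiag) (he : ∀ v, 2 ∣ dg F v)
    (hc : Conn F) (v : V) :
    ∃ c : (gr F).Walk v v, c.IsTrail ∧ ∀ e ∈ F, e ∈ c.edges := by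
  classical
  let P : ℕ → Prop := fun n => ∃ p : (gr F).Walk v v, p.IsTrail ∧ p.length = n
  have hP0 : P 0 := ⟨Walk.nil, Walk.IsTrail.nil, rfl⟩
  let n := Nat.findGreatest P F.card
  have hPn : P n := Nat.findGreatest_spec (Nat.zero_le _) hP0
  have hmax : ∀ p : (gr F).Walk v v, p.IsTrail → p.length ≤ n := fun p hp =>
    Nat.le_findGreatest (trail_len p hp) ⟨p, hp, rfl⟩
  obtain ⟨c, hct, hlen⟩ := hPn
  refine ⟨c, hct, ?_⟩
  by_contra hcon
  push Not at hcon
  obtain ⟨e, heF, hec⟩ := hcon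
  have hx : ∃ x y, x ∈ c.support ∧ s(x, y) ∈ F ∧ s(x, y) ∉ c.edges := by
    by_contra hno
    push Not at hno
    have hall : ∀ u, u ∈ c.support := by
      intro u
      refine reach_closed (P := fun u => u ∈ c.support) ?_ (hc v u) (Walk.start_mem_support _)
      intro x y hxy hx
      rw [fromEdgeSet_adj] at hxy
      exact Walk.snd_mem_support_of_mem_edges _ (hno x y hx hxy.1)
    induction e using Sym2.ind with | _ x y => exact hec (hno x y (hall x) heF)
  obtain ⟨x, y, hxs, hxyF, hxyc⟩ := hx
  let F' := F \ c.edges.toFinset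
  have hF' : ∀ u, 2 ∣ dg F' u := by
    intro u
    have h1 : dg F' u + dg c.edges.toFinset u = dg F u := dg_sdiff (by
      intro e he; exact gr_edges c (List.mem_toFinset.1 he)) u
    have h2 := (hct.even_countP_edges_iff u).2 (by simp)
    rw [countP_eq hct.edges_nodup, even_iff_two_dvd] at h2
    have h3 := he u
    omega
  obtain ⟨c', hct', hc'⟩ := euler0 F' (fun e he => hl e (Finset.sdiff_subset he)) hF' x
  have hmem := hc' s(x, y) (by simp [F', hxyF, hxyc]) (by simp)
  have hle : gr F' ≤ gr F := fromEdgeSet_mono (by exact_mod_cast Finset.sdiff_subset)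
  let c2 := c'.mapLe hle
  have hc2e : c2.edges = c'.edges := by simp [c2]
  let d := (c.takeUntil x hxs).append (c2.append (c.dropUntil x hxs))
  have hperm : d.edges.Perm (c.edges ++ c'.edges) := by
    have h1 : c.edges = (c.takeUntil x hxs).edges ++ (c.dropUntil x hxs).edges := by
      rw [← Walk.edges_append, Walk.take_spec]
    rw [h1]
    simp only [d, Walk.edges_append, hc2e, List.append_assoc]
    exact List.Perm.append_left _ List.perm_append_comm
  have hdt : d.IsTrail := by
    rw [Walk.isTrail_def, hperm.nodup_iff, List.nodup_append]
    refine ⟨hct.edges_nodup, hct'.edges_nodup, ?_⟩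
    rintro a ha b hb rfl
    have := gr_edges c' hb
    simp [F', ha] at this
  have h1 := hmax d hdt
  have h2 := hperm.length_eq
  rw [List.length_append, Walk.length_edges, Walk.length_edges, Walk.length_edges] at h2
  have h3 : 0 < c'.length := by
    rw [← Walk.length_edges]
    exact List.length_pos_of_mem hmem
  omega

/-- the edge traversed at step `i` -/
abbrev ed (w : ℕ → V) (i : ℕ) : Sym2 V := s(w i, w (i + 1))

lemma walk_fun {F : Finset (Sym2 V)} {v : V} (c : (gr F).Walk v v) (hc : c.IsTrail) :
    ∃ (L : ℕ) (w : ℕ → V), w 0 = v ∧ w L = v ∧ L = c.length ∧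
      Set.InjOn (ed w) (Finset.range L) ∧ (Finset.range L).image (ed w) = c.edges.toFinset := by
  refine ⟨c.length, c.getVert, by simp, by simp, rfl, ?_, ?_⟩
  · have h := hc.edges_nodup
    rw [edges_eq_map] at h
    intro i hi j hj hij
    have := List.inj_on_of_nodup_map h
    exact this (by simpa using hi) (by simpa using hj) hij
  · rw [edges_eq_map]
    ext e
    simp

lemma euler1 (F : Finset (Sym2 V)) (hl : ∀ e ∈ F, ¬ e.IsDiag) (he : ∀ v, 2 ∣ dg F v)
    (hc : Conn F) (v : V) :
    ∃ (L : ℕ) (w : ℕ → V), w 0 = v ∧ w L = v ∧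
      Set.InjOn (ed w) (Finset.range L) ∧ (Finset.range L).image (ed w) = F := by
  obtain ⟨c, h1, h2⟩ := euler1w F hl he hc v
  obtain ⟨L, w, a, b, -, d, e⟩ := walk_fun c h1
  refine ⟨L, w, a, b, d, ?_⟩
  rw [e]
  ext e
  rw [List.mem_toFinset]
  exact ⟨fun h => gr_edges c h, h2 e⟩

end P5

namespace P5

variable {V : Type} [Fintype V] [DecidableEq V]

lemma Bip.adj {σ : V → Bool} {F : Finset (Sym2 V)} (h : Bip σ F) {x y : V} (hxy : s(x, y) ∈ F) :
    σ y = !σ x := by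
  obtain ⟨a, b, ha, hb, he⟩ := h _ hxy
  rcases Sym2.eq_iff.1 he with ⟨rfl, rfl⟩ | ⟨rfl, rfl⟩ <;> simp [ha, hb]

lemma Bip.ne {σ : V → Bool} {F : Finset (Sym2 V)} (h : Bip σ F) {x y : V} (hxy : s(x, y) ∈ F) :
    x ≠ y := by
  rintro rfl
  have := h.adj hxy
  simp at this

lemma alt {σ : V → Bool} {F : Finset (Sym2 V)} (h : Bip σ F) {L : ℕ} {w : ℕ → V}
    (hw : ∀ i < L, ed w i ∈ F) : ∀ i ≤ L, σ (w i) = if i % 2 = 0 then σ (w 0) else !σ (w 0) := by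
  intro i
  induction i with
  | zero => simp
  | succ i ih =>
    intro hi
    rw [h.adj (hw i (by omega)), ih (by omega)]
    by_cases h2 : i % 2 = 0
    · rw [if_pos h2, if_neg (by omega)]
    · rw [if_neg h2, if_pos (by omega)]; simp

lemma alt_even {σ : V → Bool} {F : Finset (Sym2 V)} (h : Bip σ F) {L : ℕ} {w : ℕ → V}
    (hw : ∀ i < L, ed w i ∈ F) (hL : w L = w 0) : L % 2 = 0 := by
  have := alt h hw L le_rfl
  by_contra hne
  rw [if_neg hne, hL] at this
  simp at this

/-- indicator -/
def ind (w : ℕ → V) (v : V) (i : ℕ) : ℕ := if w i = v then 1 else 0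

lemma dg_image {w : ℕ → V} {J : Finset ℕ} (hJ : Set.InjOn (ed w) J)
    (hl : ∀ i ∈ J, w i ≠ w (i + 1)) (v : V) :
    dg (J.image (ed w)) v = ∑ i ∈ J, (ind w v i + ind w v (i + 1)) := by
  unfold dg
  rw [Finset.card_filter, Finset.sum_image hJ]
  refine Finset.sum_congr rfl fun i hi => ?_
  have := hl i hi
  unfold ind
  simp only [ed, Sym2.mem_iff]
  by_cases h1 : w i = v
  · have h2 : w (i + 1) ≠ v := fun h => this (h1.trans h.symm)
    simp [h1, h2]
  · by_cases h2 : w (i + 1) = v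
    · simp [h1, h2]
    · simp [h1, h2, Ne.symm h1, Ne.symm h2]

lemma sum_pairs (f : ℕ → ℕ) (m : ℕ) :
    ∑ j ∈ Finset.range (2 * m), f j = ∑ i ∈ Finset.range m, (f (2 * i) + f (2 * i + 1)) := by
  induction m with
  | zero => simp
  | succ m ih =>
    rw [show 2 * (m + 1) = 2 * m + 1 + 1 by ring, Finset.sum_range_succ, Finset.sum_range_succ, ih,
      Finset.sum_range_succ]
    ring

lemma sum_shift (f : ℕ → ℕ) (L : ℕ) (h : f L = f 0) :
    ∑ j ∈ Finset.range L, f (j + 1) = ∑ j ∈ Finset.range L, f j := by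
  have h1 := Finset.sum_range_succ f L
  have h2 := Finset.sum_range_succ' f L
  omega

lemma halving (σ : V → Bool) : ∀ (n : ℕ) (F : Finset (Sym2 V)), F.card = n → Bip σ F →
    (∀ v, 2 ∣ dg F v) → ∃ Y, Y ⊆ F ∧ ∀ v, 2 * dg Y v = dg F v := by
  intro n
  induction n using Nat.strong_induction_on with
  | _ n ih =>
  intro F hn hb he
  rcases F.eq_empty_or_nonempty with rfl | ⟨e, heF⟩
  · exact ⟨∅, by simp, by simp [dg]⟩
  induction e using Sym2.ind with | _ v y =>
  obtain ⟨c, hc, hcv⟩ := euler0 F hb.loopless he v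
  obtain ⟨L, w, h0, hL, -, hinj, himg⟩ := walk_fun c hc
  have hvy : s(v, y) ∈ (Finset.range L).image (ed w) := by
    rw [himg, List.mem_toFinset]; exact hcv _ heF (by simp)
  set Cs := (Finset.range L).image (ed w) with hCs
  have hCF : Cs ⊆ F := by
    intro e he
    rw [himg, List.mem_toFinset] at he
    exact gr_edges c he
  have hw : ∀ i < L, ed w i ∈ F := fun i hi =>
    hCF (Finset.mem_image_of_mem _ (Finset.mem_range.2 hi))
  have hL2 := alt_even hb hw (hL.trans h0.symm)
  obtain ⟨m, rfl⟩ : ∃ m, L = 2 * m := ⟨L / 2, by omega⟩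
  have hne : ∀ i < 2 * m, w i ≠ w (i + 1) := fun i hi => hb.ne (hw i hi)
  let J := (Finset.range m).image (fun i => 2 * i)
  have hJ : J ⊆ Finset.range (2 * m) := by
    intro i
    simp only [J, Finset.mem_image, Finset.mem_range]
    rintro ⟨j, hj, rfl⟩; omega
  have hdC : ∀ v, dg Cs v = 2 * ∑ j ∈ Finset.range (2 * m), ind w v j := by
    intro v
    rw [hCs, dg_image hinj (fun i hi => hne i (Finset.mem_range.1 hi)), Finset.sum_add_distrib,
      sum_shift (ind w v) _ (by unfold ind; rw [hL, h0])]
    ring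
  have hdY : ∀ v, dg (J.image (ed w)) v = ∑ j ∈ Finset.range (2 * m), ind w v j := by
    intro v
    rw [dg_image (hinj.mono (by exact_mod_cast hJ))
      (fun i hi => hne i (Finset.mem_range.1 (hJ hi))), Finset.sum_image (by
        intro a _ b _ h; simpa using h), sum_pairs]
  have hYC : J.image (ed w) ⊆ Cs := Finset.image_subset_image hJ
  have hds := fun u => dg_sdiff hCF u
  obtain ⟨Y', hY', hdY'⟩ := ih (F \ Cs).card (by
      rw [← hn]
      exact Finset.card_lt_card (Finset.sdiff_ssubset hCF ⟨_, hvy⟩)) (F \ Cs) rfl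
    (hb.mono Finset.sdiff_subset) (by
      intro u
      have h1 := hds u
      have h2 := hdC u
      have h3 := he u
      omega)
  refine ⟨J.image (ed w) ∪ Y', Finset.union_subset (hYC.trans hCF)
    (hY'.trans Finset.sdiff_subset), fun u => ?_⟩
  rw [dg_union (Finset.disjoint_of_subset_left hYC
    (Finset.disjoint_of_subset_right hY' Finset.disjoint_sdiff))]
  have h1 := hds u
  have h2 := hdC u
  have h3 := hdY u
  have h4 := hdY' u
  omega

lemma mlemma {σ : V → Bool} {H : Finset (Sym2 V)} (hb : Bip σ H) (he : ∀ v, 2 ∣ dg H v)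
    (hc : Conn H) [Nontrivial V] (b0 : V) (hb0 : σ b0 = false) (t : V → ZMod 2)
    (ht : ∑ v with σ v = false, t v = ((H.card / 2 : ℕ) : ZMod 2)) :
    ∃ M, M ⊆ H ∧ (∀ a, σ a = true → dg M a = dg H a / 2) ∧
      ∀ b, σ b = false → (dg M b : ZMod 2) = t b := by
  classical
  obtain ⟨L, w, h0, hL, hinj, himg⟩ := euler1 H hb.loopless he hc b0
  have hcard : H.card = L := by
    rw [← himg, Finset.card_image_of_injOn hinj, Finset.card_range]
  have hw : ∀ i < L, ed w i ∈ H := fun i hi => by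
    rw [← himg]; exact Finset.mem_image_of_mem _ (Finset.mem_range.2 hi)
  have hL2 := alt_even hb hw (hL.trans h0.symm)
  obtain ⟨m, rfl⟩ : ∃ m, L = 2 * m := ⟨L / 2, by omega⟩
  have hne : ∀ i < 2 * m, w i ≠ w (i + 1) := fun i hi => hb.ne (hw i hi)
  have hA : ∀ i < m, σ (w (2 * i + 1)) = true := by
    intro i hi
    rw [alt hb hw (2 * i + 1) (by omega), if_neg (by omega), h0, hb0]; rfl
  have hB : ∀ i ≤ m, σ (w (2 * i)) = false := by
    intro i hi
    rw [alt hb hw (2 * i) (by omega), if_pos (by omega), h0, hb0]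
  let δ : V → V → ZMod 2 := fun v => Pi.single v 1
  let z : ℕ → V → ZMod 2 := fun i => δ (w (2 * i)) + δ (w (2 * i + 2))
  let τ : V → ZMod 2 := fun v =>
    if σ v = false then t v + ∑ i ∈ Finset.range m, δ (w (2 * i)) v else 0
  have hτ : ∑ v, τ v = 0 := by
    rw [sum_split σ]
    have e1 : ∑ v with σ v = true, τ v = 0 := by
      refine Finset.sum_eq_zero fun v hv => ?_
      simp only [Finset.mem_filter] at hv
      simp [τ, hv.2]
    have e2 : ∑ v with σ v = false, τ v =
        ∑ v with σ v = false, t v + ∑ v with σ v = false, ∑ i ∈ Finset.range m, δ (w (2 * i)) v := by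
      rw [← Finset.sum_add_distrib]
      refine Finset.sum_congr rfl fun v hv => ?_
      simp only [Finset.mem_filter] at hv
      simp [τ, hv.2]
    have e3 : ∑ v with σ v = false, ∑ i ∈ Finset.range m, δ (w (2 * i)) v = (m : ZMod 2) := by
      rw [Finset.sum_comm]
      have : ∀ i ∈ Finset.range m, ∑ v with σ v = false, δ (w (2 * i)) v = (1 : ZMod 2) := by
        intro i hi
        simp only [δ, Pi.single_apply, Finset.sum_ite_eq', Finset.mem_filter, Finset.mem_univ,
          true_and, hB i (Finset.mem_range.1 hi).le, if_true]
      rw [Finset.sum_congr rfl this]; simp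
    rw [e1, e2, e3, ht, hcard, Nat.mul_div_cancel_left _ (by norm_num), zero_add]
    exact CharTwo.add_self_eq_zero _
  let S := Submodule.span (ZMod 2) (z '' (Finset.range m : Set ℕ))
  have hS1 : ∀ i ≤ m, δ (w (2 * i)) + δ b0 ∈ S := by
    intro i
    induction i with
    | zero => intro _; simp only [Nat.mul_zero, h0]; rw [zz]; exact S.zero_mem
    | succ i ih =>
      intro hi
      have h1 := ih (by omega)
      have h2 : z i ∈ S := Submodule.subset_span ⟨i, by simp; omega, rfl⟩
      have h3 := S.add_mem h1 h2
      have e : δ (w (2 * i)) + δ b0 + z i = (δ (w (2 * (i + 1))) + δ b0)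
          + (δ (w (2 * i)) + δ (w (2 * i))) := by
        simp only [z, Nat.mul_add, Nat.mul_one]; abel
      rw [e, zz, add_zero] at h3
      exact h3
  have hS2 : ∀ b, σ b = false → δ b + δ b0 ∈ S := by
    intro b hbb
    have h1 := conn_dg hc b
    obtain ⟨e, he'⟩ := Finset.card_pos.1 h1
    rw [Finset.mem_filter, ← himg, Finset.mem_image] at he'
    obtain ⟨⟨j, hj, rfl⟩, hbe⟩ := he'
    rw [Finset.mem_range] at hj
    rcases Nat.even_or_odd' j with ⟨i, rfl | rfl⟩
    · rcases Sym2.mem_iff.1 hbe with h | h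
      · rw [h]; exact hS1 i (by omega)
      · rw [h, hA i (by omega)] at hbb; simp at hbb
    · rcases Sym2.mem_iff.1 hbe with h | h
      · rw [h, hA i (by omega)] at hbb; simp at hbb
      · rw [h]; exact hS1 (i + 1) (by omega)
  have hmem : τ ∈ S := by
    have : τ = ∑ v, τ v • (δ v + δ b0) := by
      simp only [smul_add, Finset.sum_add_distrib, ← Finset.sum_smul, hτ, zero_smul, add_zero]
      funext x
      simp [Finset.sum_apply, δ, Pi.single_apply]
    rw [this]
    refine Submodule.sum_mem _ fun v _ => ?_
    by_cases hv : σ v = false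
    · exact S.smul_mem _ (hS2 v hv)
    · simp [τ, hv]
  rw [Submodule.mem_span_image_finset_iff_exists_fun'] at hmem
  obtain ⟨c, hcc⟩ := hmem
  let q : ℕ → ℕ := fun i => 2 * i + (if c i = 0 then 0 else 1)
  have hq : ∀ i, q i / 2 = i := by intro i; simp only [q]; split <;> omega
  have hqi : Set.InjOn q (Finset.range m) := by
    intro i _ j _ h
    rw [← hq i, ← hq j, h]
  let J := (Finset.range m).image q
  have hJ : J ⊆ Finset.range (2 * m) := by
    intro i
    simp only [J, Finset.mem_image, Finset.mem_range]
    rintro ⟨j, hj, rfl⟩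
    have := hq j
    omega
  have hdM : ∀ v, dg (J.image (ed w)) v =
      ∑ i ∈ Finset.range m, (ind w v (q i) + ind w v (q i + 1)) := by
    intro v
    rw [dg_image (hinj.mono (by exact_mod_cast hJ))
      (fun i hi => hne i (Finset.mem_range.1 (hJ hi))), Finset.sum_image hqi]
  refine ⟨J.image (ed w), ?_, ?_, ?_⟩
  · rw [← himg]; exact Finset.image_subset_image hJ
  · intro a ha
    have hz : ∀ i ≤ m, ind w a (2 * i) = 0 := by
      intro i hi
      unfold ind
      rw [if_neg]
      rintro rfl
      rw [hB i hi] at ha; simp at ha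
    have h1 : dg H a = 2 * ∑ i ∈ Finset.range m, ind w a (2 * i + 1) := by
      conv_lhs => rw [← himg]
      rw [dg_image hinj (fun i hi => hne i (Finset.mem_range.1 hi)), Finset.sum_add_distrib,
        sum_shift (ind w a) _ (by unfold ind; rw [hL, h0]), sum_pairs]
      have : ∀ i ∈ Finset.range m, ind w a (2 * i) + ind w a (2 * i + 1) = ind w a (2 * i + 1) := by
        intro i hi
        rw [hz i (Finset.mem_range.1 hi).le, zero_add]
      rw [Finset.sum_congr rfl this]
      ring
    rw [h1, Nat.mul_div_cancel_left _ (by norm_num), hdM]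
    refine Finset.sum_congr rfl fun i hi => ?_
    have hi' := Finset.mem_range.1 hi
    simp only [q]
    split
    · rw [add_zero, hz i hi'.le, zero_add]
    · have := hz (i + 1) (by omega)
      rw [show 2 * i + 1 + 1 = 2 * (i + 1) by ring, this, add_zero]
  · intro b hbb
    have hz : ∀ i < m, ind w b (2 * i + 1) = 0 := by
      intro i hi
      unfold ind
      rw [if_neg]
      rintro rfl
      rw [hA i hi] at hbb; simp at hbb
    have hind : ∀ j, ((ind w b j : ℕ) : ZMod 2) = δ (w j) b := by
      intro j
      simp only [ind, δ, Pi.single_apply]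
      by_cases h : w j = b
      · simp [h]
      · simp [h, Ne.symm h]
    have h1 := congrFun hcc b
    simp only [τ, hbb, if_true, Finset.sum_apply, Pi.smul_apply, smul_eq_mul] at h1
    rw [hdM, Nat.cast_sum]
    have h2 : ∀ i ∈ Finset.range m, ((ind w b (q i) + ind w b (q i + 1) : ℕ) : ZMod 2)
        = δ (w (2 * i)) b + c i * z i b := by
      intro i hi
      have hi' := Finset.mem_range.1 hi
      have h01 : ∀ x : ZMod 2, x = 0 ∨ x = 1 := by decide
      simp only [q]
      rcases h01 (c i) with h | h
      · simp only [h, if_true, add_zero, hz i hi', zero_mul, hind]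
      · have hn1 : (1 : ZMod 2) ≠ 0 := by decide
        simp only [h, if_neg hn1, hz i hi', zero_add, one_mul, hind, z, Pi.add_apply]
        rw [← add_assoc, CharTwo.add_self_eq_zero, zero_add]
    rw [Finset.sum_congr rfl h2, Finset.sum_add_distrib, h1, add_comm (t b), ← add_assoc,
      CharTwo.add_self_eq_zero, zero_add]

end P5

namespace P5

variable {V : Type} [Fintype V] [DecidableEq V]

lemma mkclass {σ : V → Bool} {H P : Finset (Sym2 V)} (hb : Bip σ H) (hbP : Bip σ P)
    (he : ∀ v, 2 ∣ dg H v)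
    (hc : Conn H) [Nontrivial V] (b0 : V) (hb0 : σ b0 = false) (hd : Disjoint H P)
    (κ τ : V → ℕ) (hκ : ∀ a, σ a = true → dg H a / 2 + dg P a = κ a)
    (hτ : (∑ v with σ v = false, τ v) % 2 = (∑ v with σ v = true, κ v) % 2) :
    ∃ X, P ⊆ X ∧ X ⊆ H ∪ P ∧ (∀ a, σ a = true → dg X a = κ a) ∧
      ∀ b, σ b = false → dg X b % 2 = τ b % 2 := by
  have hH : ∑ v with σ v = true, dg H v / 2 = H.card / 2 := by
    have h1 := bip_sum hb
    have h2 : ∑ v with σ v = true, dg H v = 2 * ∑ v with σ v = true, dg H v / 2 := by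
      rw [Finset.mul_sum]
      refine Finset.sum_congr rfl fun v _ => ?_
      have := he v
      omega
    omega
  have hs : ∑ v with σ v = true, κ v = H.card / 2 + P.card := by
    rw [← bip_sum hbP, ← hH, ← Finset.sum_add_distrib]
    refine Finset.sum_congr rfl fun v hv => ?_
    rw [hκ v (Finset.mem_filter.1 hv).2]
  obtain ⟨M, hM, hMa, hMb⟩ := mlemma hb he hc b0 hb0 (fun b => ((τ b + dg P b : ℕ) : ZMod 2)) (by
    rw [← Nat.cast_sum, Finset.sum_add_distrib, bip_sum_false hbP, cast_mod]
    omega)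
  have hdj : Disjoint M P := hd.mono_left hM
  refine ⟨M ∪ P, Finset.subset_union_right, Finset.union_subset_union_left hM, ?_, ?_⟩
  · intro a ha
    rw [dg_union hdj, hMa a ha, hκ a ha]
  · intro b hbb
    have := hMb b hbb
    rw [cast_mod] at this
    rw [dg_union hdj]
    omega

structure Classes (σ : V → Bool) (E : Finset (Sym2 V)) where
  (X1 X2 X3 R : Finset (Sym2 V))
  (k : V → ℕ)
  d12 : Disjoint X1 X2
  d3 : Disjoint (X1 ∪ X2) X3
  dR : Disjoint (X1 ∪ X2 ∪ X3) R
  un : X1 ∪ X2 ∪ X3 ∪ R = E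
  a1 : ∀ a, σ a = true → dg X1 a = k a
  a2 : ∀ a, σ a = true → dg X2 a = 2 * k a
  a3 : ∀ a, σ a = true → dg X3 a = 2 * k a
  k2 : ∀ a, σ a = true → 2 ≤ k a
  b2 : ∀ b, σ b = false → 2 ∣ dg X2 b
  b24 : ∀ b, σ b = false → 4 ≤ dg X2 b
  b3 : ∀ b, σ b = false → 2 ∣ dg X3 b
  eR : ∀ v, 2 ∣ dg R v
  cR : Conn R
  R5 : 5 ∣ R.card

lemma classes {σ : V → Bool} {E : Finset (Sym2 V)} (hb : Bip σ E) [Nontrivial V]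
    (S : Setup σ E) (b0 : V) (hb0 : σ b0 = false) (h5 : 5 ∣ E.card) : Nonempty (Classes σ E) := by
  classical
  have dis := S.dis
  simp only [List.pairwise_cons, List.mem_cons, forall_eq_or_imp, List.not_mem_nil] at dis
  obtain ⟨⟨t1, t2, t3, t4, t5, t6, -⟩, ⟨p1, p2, p3, p4, p5, -⟩, ⟨q1, q2, q3, q4, -⟩,
    ⟨r1, r2, r3, -⟩, ⟨s1, s2, -⟩, ⟨u1, -⟩, -⟩ := dis
  have hsum2 : (∑ v with σ v = true, 2 * S.k v) % 2 = 0 := by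
    rw [← Finset.mul_sum]; omega
  obtain ⟨X1, PX1, XP1, A1, B1⟩ := mkclass (hb.mono S.hH1) (hb.mono S.hP1) S.eH1 S.cH1 b0 hb0 p3
    S.k (dg E) S.d1 (by
      rw [bip_sum_false hb, ← bip_sum hb, Finset.sum_nat_mod,
        Finset.sum_nat_mod _ _ S.k]
      congr 1
      refine Finset.sum_congr rfl fun v hv => ?_
      rw [S.kd v (Finset.mem_filter.1 hv).2])
  obtain ⟨X2, PX2, XP2, A2, B2⟩ := mkclass (hb.mono S.hH2) (hb.mono S.hP2) S.eH2 S.cH2 b0 hb0 q3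
    (fun v => 2 * S.k v) (fun _ => 0) S.d2 (by rw [hsum2]; simp)
  obtain ⟨X3, PX3, XP3, A3, B3⟩ := mkclass (hb.mono S.hH3) (hb.mono S.hP3) S.eH3 S.cH3 b0 hb0 r3
    (fun v => 2 * S.k v) (fun _ => 0) S.d3 (by rw [hsum2]; simp)
  have E1 : X1 ⊆ E := XP1.trans (Finset.union_subset S.hH1 S.hP1)
  have E2 : X2 ⊆ E := XP2.trans (Finset.union_subset S.hH2 S.hP2)
  have E3 : X3 ⊆ E := XP3.trans (Finset.union_subset S.hH3 S.hP3)
  have D12 : Disjoint X1 X2 := by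
    refine Disjoint.mono XP1 XP2 ?_
    simp only [Finset.disjoint_union_left, Finset.disjoint_union_right]
    exact ⟨⟨p1, q2.symm⟩, p4, s1⟩
  have D13 : Disjoint X1 X3 := by
    refine Disjoint.mono XP1 XP3 ?_
    simp only [Finset.disjoint_union_left, Finset.disjoint_union_right]
    exact ⟨⟨p2, r1.symm⟩, p5, s2⟩
  have D23 : Disjoint X2 X3 := by
    refine Disjoint.mono XP2 XP3 ?_
    simp only [Finset.disjoint_union_left, Finset.disjoint_union_right]
    exact ⟨⟨q1, r2.symm⟩, q4, u1⟩
  have D3 : Disjoint (X1 ∪ X2) X3 := Finset.disjoint_union_left.2 ⟨D13, D23⟩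
  have XE : X1 ∪ X2 ∪ X3 ⊆ E := Finset.union_subset (Finset.union_subset E1 E2) E3
  have TX : Disjoint S.T0 (X1 ∪ X2 ∪ X3) := by
    simp only [Finset.disjoint_union_right]
    refine ⟨⟨Disjoint.mono_right XP1 ?_, Disjoint.mono_right XP2 ?_⟩, Disjoint.mono_right XP3 ?_⟩ <;>
    simp only [Finset.disjoint_union_right]
    · exact ⟨t1, t4⟩
    · exact ⟨t2, t5⟩
    · exact ⟨t3, t6⟩
  have hdR : ∀ v, dg (E \ (X1 ∪ X2 ∪ X3)) v + (dg X1 v + dg X2 v + dg X3 v) = dg E v := by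
    intro v
    rw [← dg_sdiff XE v, dg_union D3, dg_union D12]
  refine ⟨⟨X1, X2, X3, E \ (X1 ∪ X2 ∪ X3), S.k, D12, D3, Finset.disjoint_sdiff,
    Finset.union_sdiff_of_subset XE, A1, A2, A3, S.k2, ?_, ?_, ?_, ?_, ?_, ?_⟩⟩
  · intro b h
    have := B2 b h
    omega
  · intro b h
    have h1 := B2 b h
    have h2 := S.three b
    have h3 := dg_mono PX2 b
    omega
  · intro b h
    have := B3 b h
    omega
  · intro v
    have h1 := hdR v
    cases hv : σ v
    · have h2 := B1 v hv
      have h3 := B2 v hv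
      have h4 := B3 v hv
      omega
    · have h2 := A1 v hv
      have h3 := A2 v hv
      have h4 := A3 v hv
      have h5 := S.kd v hv
      omega
  · refine S.cT0.mono ?_
    intro e he
    exact Finset.mem_sdiff.2 ⟨S.hT0 he, Finset.disjoint_left.1 TX he⟩
  · have h1 := Finset.card_sdiff_add_card_eq_card XE
    rw [Finset.card_union_of_disjoint D3, Finset.card_union_of_disjoint D12, ← bip_sum (hb.mono E1),
      ← bip_sum (hb.mono E2), ← bip_sum (hb.mono E3)] at h1
    have f1 : ∑ v with σ v = true, dg X1 v = ∑ v with σ v = true, S.k v :=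
      Finset.sum_congr rfl fun v hv => A1 v (Finset.mem_filter.1 hv).2
    have f2 : ∑ v with σ v = true, dg X2 v = 2 * ∑ v with σ v = true, S.k v := by
      rw [Finset.mul_sum]
      exact Finset.sum_congr rfl fun v hv => A2 v (Finset.mem_filter.1 hv).2
    have f3 : ∑ v with σ v = true, dg X3 v = 2 * ∑ v with σ v = true, S.k v := by
      rw [Finset.mul_sum]
      exact Finset.sum_congr rfl fun v hv => A3 v (Finset.mem_filter.1 hv).2
    rw [f1, f2, f3] at h1
    omega

end P5

namespace P5

structure Core (V : Type) where
  (p x y q : V)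

def Core.e1 {V : Type} (c : Core V) : Sym2 V := s(c.p, c.x)
def Core.e2 {V : Type} (c : Core V) : Sym2 V := s(c.x, c.y)
def Core.e3 {V : Type} (c : Core V) : Sym2 V := s(c.y, c.q)

def cEdges {V : Type} (C : Multiset (Core V)) : Multiset (Sym2 V) :=
  C.map Core.e1 + C.map Core.e2 + C.map Core.e3

def kEdges {V : Type} (K : Multiset (V × V)) : Multiset (Sym2 V) := K.map (fun k => s(k.1, k.2))

def ends {V : Type} (C : Multiset (Core V)) : Multiset V := C.map Core.p + C.map Core.q

structure Sys {V : Type} (σ : V → Bool) (U : Multiset (Sym2 V)) (C : Multiset (Core V))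
    (K : Multiset (V × V)) : Prop where
  edges : cEdges C + kEdges K = U
  bal : ends C = K.map Prod.snd
  side : ∀ c ∈ C, σ c.p = false

lemma ends_add {V : Type} (C C' : Multiset (Core V)) : ends (C + C') = ends C + ends C' := by
  simp only [ends, Multiset.map_add]; abel

lemma cEdges_add {V : Type} (C C' : Multiset (Core V)) : cEdges (C + C') = cEdges C + cEdges C' := by
  simp only [cEdges, Multiset.map_add]; abel

lemma kEdges_add {V : Type} (C C' : Multiset (V × V)) : kEdges (C + C') = kEdges C + kEdges C' := by
  simp only [kEdges, Multiset.map_add]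

lemma Sys.add {V : Type} {σ : V → Bool} {U U' : Multiset (Sym2 V)} {C C' : Multiset (Core V)}
    {K K' : Multiset (V × V)} (h : Sys σ U C K) (h' : Sys σ U' C' K') :
    Sys σ (U + U') (C + C') (K + K') := by
  refine ⟨?_, ?_, ?_⟩
  · rw [← h.edges, ← h'.edges, cEdges_add, kEdges_add]; abel
  · rw [ends_add, h.bal, h'.bal, Multiset.map_add]
  · intro c hc
    rcases Multiset.mem_add.1 hc with hc | hc
    · exact h.side c hc
    · exact h'.side c hc

lemma rel_pairs {α β : Type*} {R : α → β → Prop} {S : Multiset α} {T : Multiset β}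
    (h : Multiset.Rel R S T) :
    ∃ W : Multiset (α × β), W.map Prod.fst = S ∧ W.map Prod.snd = T ∧ ∀ w ∈ W, R w.1 w.2 := by
  induction h with
  | zero => exact ⟨0, by simp, by simp, by simp⟩
  | @cons a b as bs hab _ ih =>
    obtain ⟨W, h1, h2, h3⟩ := ih
    refine ⟨(a, b) ::ₘ W, by simp [h1], by simp [h2], ?_⟩
    intro w hw
    rcases Multiset.mem_cons.1 hw with rfl | hw
    · exact hab
    · exact h3 w hw

lemma pairs_of_map_eq {α β γ : Type*} {S : Multiset α} {T : Multiset β} (f : α → γ) (g : β → γ)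
    (h : S.map f = T.map g) :
    ∃ W : Multiset (α × β), W.map Prod.fst = S ∧ W.map Prod.snd = T ∧ ∀ w ∈ W, f w.1 = g w.2 := by
  rw [← Multiset.rel_eq, Multiset.rel_map] at h
  exact rel_pairs (R := fun a b => f a = g b) h

variable {V : Type} [Fintype V] [DecidableEq V]

lemma count_al {σ : V → Bool} {E : Finset (Sym2 V)} {al : Sym2 V → V} {s : Bool}
    (hal : ∀ e ∈ E, ∀ a, al e = a ↔ (a ∈ e ∧ σ a = s)) {F : Finset (Sym2 V)} (hF : F ⊆ E) (a : V) :
    (F.val.map al).count a = if σ a = s then dg F a else 0 := by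
  rw [Multiset.count_map]
  by_cases h : σ a = s
  · rw [if_pos h]
    unfold dg
    rw [← Finset.filter_val, Finset.card_val]
    congr 1
    refine Finset.filter_congr fun e he => ?_
    rw [eq_comm, hal e (hF he)]
    exact ⟨fun h => h.1, fun h' => ⟨h', h⟩⟩
  · rw [if_neg h, ← Finset.filter_val, Finset.card_val, Finset.card_eq_zero,
      Finset.filter_eq_empty_iff]
    intro e he heq
    exact h ((hal e (hF he) a).1 heq.symm).2

lemma sysG1 {σ : V → Bool} {E : Finset (Sym2 V)} (hb : Bip σ E) (D : Classes σ E) :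
    ∃ C K, Sys σ (D.X1.val + D.X2.val + D.X3.val) C K ∧ ∀ v, 2 ≤ (ends C).count v := by
  obtain ⟨al, hal⟩ := hb.al
  obtain ⟨bl, hbl'⟩ := hb.neg.al
  have hbl : ∀ e ∈ E, ∀ b, bl e = b ↔ (b ∈ e ∧ σ b = false) := by simpa using hbl'
  have X1E : D.X1 ⊆ E := fun e he => by rw [← D.un]; simp [he]
  have X2E : D.X2 ⊆ E := fun e he => by rw [← D.un]; simp [he]
  have X3E : D.X3 ⊆ E := fun e he => by rw [← D.un]; simp [he]
  obtain ⟨Y2, hY2, dY2⟩ := halving σ _ D.X2 rfl (hb.mono X2E) (by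
    intro v
    cases h : σ v
    · exact D.b2 v h
    · rw [D.a2 v h]; exact dvd_mul_right _ _)
  obtain ⟨Y3, hY3, dY3⟩ := halving σ _ D.X3 rfl (hb.mono X3E) (by
    intro v
    cases h : σ v
    · exact D.b3 v h
    · rw [D.a3 v h]; exact dvd_mul_right _ _)
  have dZ2 := fun v => dg_sdiff hY2 v
  have dZ3 := fun v => dg_sdiff hY3 v
  set Z2 := D.X2 \ Y2 with hZ2
  set Z3 := D.X3 \ Y3 with hZ3
  have Z2E : Z2 ⊆ E := Finset.sdiff_subset.trans X2E
  have Z3E : Z3 ⊆ E := Finset.sdiff_subset.trans X3E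
  have Y2E : Y2 ⊆ E := hY2.trans X2E
  have Y3E : Y3 ⊆ E := hY3.trans X3E
  have m1 : Z2.val.map al = Y3.val.map al := by
    ext a
    rw [count_al hal Z2E, count_al hal Y3E]
    split
    · rename_i h
      have h1 := D.a2 a h
      have h2 := D.a3 a h
      have h3 := dZ2 a
      have h4 := dY2 a
      have h5 := dY3 a
      omega
    · rfl
  obtain ⟨W1, w1, w2, w3⟩ := pairs_of_map_eq al al m1
  have m2 : W1.map (fun w => bl w.2) = Z3.val.map bl := by
    have : W1.map (fun w => bl w.2) = (W1.map Prod.snd).map bl := by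
      rw [Multiset.map_map]; rfl
    rw [this, w2]
    ext b
    rw [count_al hbl Y3E, count_al hbl Z3E]
    split
    · have h3 := dZ3 b
      have h5 := dY3 b
      omega
    · rfl
  obtain ⟨W, v1, v2, v3⟩ := pairs_of_map_eq _ _ m2
  have hed : ∀ e ∈ E, s(al e, bl e) = e := by
    intro e he
    obtain ⟨a, b, ha, hb', rfl⟩ := hb e he
    rw [(hal _ he a).2 ⟨by simp, ha⟩, (hbl _ he b).2 ⟨by simp, hb'⟩]
  have u1 : W.map (fun w => w.1.1) = Z2.val := by
    rw [← w1, ← v1, Multiset.map_map]; rfl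
  have u2 : W.map (fun w => w.1.2) = Y3.val := by
    rw [← w2, ← v1, Multiset.map_map]; rfl
  have wE : ∀ w ∈ W, w.1.1 ∈ E ∧ w.1.2 ∈ E ∧ w.2 ∈ E ∧ al w.1.1 = al w.1.2 ∧ bl w.1.2 = bl w.2 := by
    intro w hw
    refine ⟨Z2E ?_, Y3E ?_, Z3E ?_, w3 w.1 ?_, v3 w hw⟩
    · rw [← Finset.mem_val, ← u1]; exact Multiset.mem_map_of_mem (fun w => w.1.1) hw
    · rw [← Finset.mem_val, ← u2]; exact Multiset.mem_map_of_mem (fun w => w.1.2) hw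
    · rw [← Finset.mem_val, ← v2]; exact Multiset.mem_map_of_mem Prod.snd hw
    · rw [← v1]; exact Multiset.mem_map_of_mem Prod.fst hw
  let mk : (Sym2 V × Sym2 V) × Sym2 V → Core V := fun w => ⟨bl w.1.1, al w.1.2, bl w.1.2, al w.2⟩
  have f1 : (W.map mk).map Core.e1 = Z2.val := by
    rw [Multiset.map_map, ← u1]
    refine Multiset.map_congr rfl fun w hw => ?_
    obtain ⟨a, b, c, d, e⟩ := wE w hw
    simp only [Function.comp, mk, Core.e1]
    rw [← d, Sym2.eq_swap, hed _ a]
  have f2 : (W.map mk).map Core.e2 = Y3.val := by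
    rw [Multiset.map_map, ← u2]
    refine Multiset.map_congr rfl fun w hw => ?_
    obtain ⟨a, b, c, d, e⟩ := wE w hw
    simp only [Function.comp, mk, Core.e2]
    rw [hed _ b]
  have f3 : (W.map mk).map Core.e3 = Z3.val := by
    rw [Multiset.map_map, ← v2]
    refine Multiset.map_congr rfl fun w hw => ?_
    obtain ⟨a, b, c, d, e⟩ := wE w hw
    simp only [Function.comp, mk, Core.e3]
    rw [e, Sym2.eq_swap, hed _ c]
  have g1 : (W.map mk).map Core.p = Z2.val.map bl := by
    rw [Multiset.map_map, ← u1, Multiset.map_map]; rfl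
  have g2 : (W.map mk).map Core.q = Z3.val.map al := by
    rw [Multiset.map_map, ← v2, Multiset.map_map]; rfl
  refine ⟨W.map mk, Y2.val.map (fun e => (al e, bl e)) + D.X1.val.map (fun e => (bl e, al e)),
    ⟨?_, ?_, ?_⟩, ?_⟩
  · have k1 : kEdges (Y2.val.map (fun e => (al e, bl e))) = Y2.val := by
      unfold kEdges
      rw [Multiset.map_map]
      conv_rhs => rw [← Multiset.map_id Y2.val]
      refine Multiset.map_congr rfl fun e he => hed _ (Y2E he)
    have k2 : kEdges (D.X1.val.map (fun e => (bl e, al e))) = D.X1.val := by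
      unfold kEdges
      rw [Multiset.map_map]
      conv_rhs => rw [← Multiset.map_id D.X1.val]
      refine Multiset.map_congr rfl fun e he => ?_
      simp only [Function.comp]
      rw [Sym2.eq_swap, hed _ (X1E he)]; rfl
    have s2 : Z2.val + Y2.val = D.X2.val := by
      rw [hZ2, Finset.sdiff_val]; exact Multiset.sub_add_cancel (Finset.val_le_iff.2 hY2)
    have s3 : Z3.val + Y3.val = D.X3.val := by
      rw [hZ3, Finset.sdiff_val]; exact Multiset.sub_add_cancel (Finset.val_le_iff.2 hY3)
    rw [kEdges_add, k1, k2, cEdges, f1, f2, f3, ← s2, ← s3]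
    abel
  · unfold ends
    rw [g1, g2, Multiset.map_add, Multiset.map_map, Multiset.map_map]
    have r1 : Z2.val.map bl = Y2.val.map bl := by
      ext b
      rw [count_al hbl Z2E, count_al hbl Y2E]
      have h3 := dZ2 b
      have h5 := dY2 b
      split
      · omega
      · rfl
    have r2 : Z3.val.map al = D.X1.val.map al := by
      ext a
      rw [count_al hal Z3E, count_al hal X1E]
      have h3 := dZ3 a
      have h5 := dY3 a
      split
      · rename_i h
        have h1 := D.a1 a h
        have h2 := D.a3 a h
        omega
      · rfl
    rw [r1, r2]; rfl
  · intro c hc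
    obtain ⟨w, hw, rfl⟩ := Multiset.mem_map.1 hc
    exact ((hbl _ (wE w hw).1 _).1 rfl).2
  · intro v
    unfold ends
    rw [g1, g2, Multiset.count_add, count_al hbl Z2E, count_al hal Z3E]
    have h1 := dZ2 v
    have h2 := dZ3 v
    have h3 := dY2 v
    have h4 := dY3 v
    cases h : σ v
    · have := D.b24 v h
      simp only [if_true]
      omega
    · have := D.a3 v h
      have := D.k2 v h
      simp only [if_true]
      omega

lemma sysG2 {σ : V → Bool} {R : Finset (Sym2 V)} (hb : Bip σ R) (w : ℕ → V) :
    ∀ n, (∀ i < 5 * n, ed w i ∈ R) →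
    ∃ C K, Sys σ ((Multiset.range (5 * n)).map (ed w)) C K := by
  intro n
  induction n with
  | zero =>
    intro _
    exact ⟨0, 0, by simp [cEdges, kEdges], by simp [ends], by simp⟩
  | succ n ih =>
    intro h
    obtain ⟨C, K, hS⟩ := ih fun i hi => h i (by omega)
    let t := 5 * n
    have hk : Multiset.map (ed w) (Multiset.range (5 * (n + 1))) =
        (Multiset.range (5 * n)).map (ed w) +
          {ed w t, ed w (t + 1), ed w (t + 2), ed w (t + 3), ed w (t + 4)} := by
      rw [show 5 * (n + 1) = t + 1 + 1 + 1 + 1 + 1 by omega]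
      simp only [Multiset.range_succ, Multiset.map_cons]
      simp only [← Multiset.singleton_add, Multiset.insert_eq_cons, t]
      abel
    have a1 := hb.adj (h (t + 1) (by omega))
    have a2 := hb.adj (h (t + 2) (by omega))
    have a3 := hb.adj (h (t + 3) (by omega))
    by_cases hs : σ (w (t + 1)) = false
    · refine ⟨C + {⟨w (t + 1), w (t + 2), w (t + 3), w (t + 4)⟩},
        K + {(w t, w (t + 1)), (w (t + 5), w (t + 4))}, ?_⟩
      rw [hk]
      refine hS.add ⟨?_, ?_, ?_⟩
      · simp only [cEdges, kEdges, Core.e1, Core.e2, Core.e3, Multiset.map_singleton,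
          Multiset.insert_eq_cons, Multiset.map_cons, ed]
        simp only [← Multiset.singleton_add]
        rw [Sym2.eq_swap (a := w (t + 5))]
        simp only [add_assoc]
        norm_num
        simp only [← Multiset.singleton_add]
        abel
      · simp [ends, Multiset.insert_eq_cons]
      · simpa using hs
    · refine ⟨C + {⟨w (t + 4), w (t + 3), w (t + 2), w (t + 1)⟩},
        K + {(w t, w (t + 1)), (w (t + 5), w (t + 4))}, ?_⟩
      rw [hk]
      refine hS.add ⟨?_, ?_, ?_⟩
      · simp only [cEdges, kEdges, Core.e1, Core.e2, Core.e3, Multiset.map_singleton,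
          Multiset.insert_eq_cons, Multiset.map_cons, ed]
        simp only [← Multiset.singleton_add]
        rw [Sym2.eq_swap (a := w (t + 5)), Sym2.eq_swap (a := w (t + 4)) (b := w (t + 3)),
          Sym2.eq_swap (a := w (t + 3)) (b := w (t + 2)),
          Sym2.eq_swap (a := w (t + 2)) (b := w (t + 1))]
        simp only [add_assoc]
        norm_num
        simp only [← Multiset.singleton_add]
        abel
      · simp only [ends, Multiset.insert_eq_cons, Multiset.map_singleton, Multiset.map_cons]
        simp only [← Multiset.singleton_add]
        abel
      · simp only [Multiset.mem_singleton, forall_eq]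
        simp only [ed, add_assoc] at a1 a2 a3
        norm_num at a1 a2 a3 hs
        rw [a3, a2, a1, hs]; rfl

lemma sysE {σ : V → Bool} {E : Finset (Sym2 V)} (hb : Bip σ E) (D : Classes σ E) [Nonempty V] :
    ∃ C K, Sys σ E.val C K ∧ ∀ v, 2 ≤ (ends C).count v := by
  obtain ⟨C1, K1, h1, h2⟩ := sysG1 hb D
  have hbR : Bip σ D.R := hb.mono (by intro e he; rw [← D.un]; simp [he])
  obtain ⟨L, w, -, -, hinj, himg⟩ := euler1 D.R hbR.loopless D.eR D.cR (Classical.arbitrary V)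
  have hcard : D.R.card = L := by
    rw [← himg, Finset.card_image_of_injOn hinj, Finset.card_range]
  obtain ⟨n, hn⟩ := D.R5
  have hLn : L = 5 * n := by omega
  subst hLn
  obtain ⟨C2, K2, h3⟩ := sysG2 hbR w n (fun i hi => by
    rw [← himg]; exact Finset.mem_image_of_mem _ (Finset.mem_range.2 hi))
  have hR : (Multiset.range (5 * n)).map (ed w) = D.R.val := by
    conv_rhs => rw [← himg]
    rw [Finset.image_val_of_injOn hinj]; rfl
  rw [hR] at h3
  have hE : D.X1.val + D.X2.val + D.X3.val + D.R.val = E.val := by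
    refine Eq.trans ?_ (congrArg Finset.val D.un)
    rw [← Finset.disjUnion_eq_union _ _ D.dR, Finset.disjUnion_val,
      ← Finset.disjUnion_eq_union _ _ D.d3, Finset.disjUnion_val,
      ← Finset.disjUnion_eq_union _ _ D.d12, Finset.disjUnion_val]
  refine ⟨C1 + C2, K1 + K2, hE ▸ h1.add h3, fun v => ?_⟩
  rw [ends_add, Multiset.count_add]
  have := h2 v
  omega

end P5

namespace P5

def prs {V : Type} (C : Multiset (Core V)) : Multiset (V × V) := C.map (fun c => (c.p, c.q))

def en {V : Type} (D : Multiset (V × V)) : Multiset V := D.map Prod.fst + D.map Prod.snd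

lemma ends_eq {V : Type} (C : Multiset (Core V)) : ends C = en (prs C) := by
  simp only [ends, en, prs, Multiset.map_map]; rfl

def Bad {V : Type} (D K : Multiset (V × V)) (v : V) : Prop :=
  ∃ w, (w, v) ∈ K ∧ ∀ d ∈ D, (d.1 = v → d.2 = w) ∧ (d.2 = v → d.1 = w)

def Rch {V : Type} (C : Multiset (Core V)) (w : V) : ℕ → V → V → Prop
  | 0, z, y => z = y
  | n + 1, z, y => ∃ x z1, (⟨z, x, z1, w⟩ : Core V) ∈ C ∧ Rch C w n z1 y

lemma rch_mono {V : Type} {C C1 : Multiset (Core V)} {w b : V}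
    (hno : ∀ z x, (⟨z, x, b, w⟩ : Core V) ∉ C) (hsub : ∀ c ∈ C, c.p ≠ b → c ∈ C1) (y : V) :
    ∀ n z, z ≠ b → Rch C w n z y → Rch C1 w n z y := by
  intro n
  induction n with
  | zero => intro z _ h; exact h
  | succ n ih =>
    rintro z hz ⟨x, z1, hc, h⟩
    refine ⟨x, z1, hsub _ hc hz, ih z1 ?_ h⟩
    rintro rfl
    exact hno _ _ hc

variable {V : Type} [Fintype V] [DecidableEq V]

lemma Sys.c1 {σ : V → Bool} {U : Multiset (Sym2 V)} {C : Multiset (Core V)}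
    {K : Multiset (V × V)} (h : Sys σ U C K) {c : Core V} (hc : c ∈ C) : s(c.p, c.x) ∈ U := by
  rw [← h.edges]
  simp only [cEdges, Multiset.mem_add, Multiset.mem_map]
  exact Or.inl (Or.inl (Or.inl ⟨c, hc, rfl⟩))

lemma Sys.c2 {σ : V → Bool} {U : Multiset (Sym2 V)} {C : Multiset (Core V)}
    {K : Multiset (V × V)} (h : Sys σ U C K) {c : Core V} (hc : c ∈ C) : s(c.x, c.y) ∈ U := by
  rw [← h.edges]
  simp only [cEdges, Multiset.mem_add, Multiset.mem_map]
  exact Or.inl (Or.inl (Or.inr ⟨c, hc, rfl⟩))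

lemma Sys.c3 {σ : V → Bool} {U : Multiset (Sym2 V)} {C : Multiset (Core V)}
    {K : Multiset (V × V)} (h : Sys σ U C K) {c : Core V} (hc : c ∈ C) : s(c.y, c.q) ∈ U := by
  rw [← h.edges]
  simp only [cEdges, Multiset.mem_add, Multiset.mem_map]
  exact Or.inl (Or.inr ⟨c, hc, rfl⟩)

lemma Sys.ck {σ : V → Bool} {U : Multiset (Sym2 V)} {C : Multiset (Core V)}
    {K : Multiset (V × V)} (h : Sys σ U C K) {k : V × V} (hk : k ∈ K) : s(k.1, k.2) ∈ U := by
  rw [← h.edges]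
  simp only [kEdges, Multiset.mem_add, Multiset.mem_map]
  exact Or.inr ⟨k, hk, rfl⟩

lemma Sys.sides {σ : V → Bool} {E : Finset (Sym2 V)} (hb : Bip σ E) {C : Multiset (Core V)}
    {K : Multiset (V × V)} (h : Sys σ E.val C K) {c : Core V} (hc : c ∈ C) :
    σ c.p = false ∧ σ c.x = true ∧ σ c.y = false ∧ σ c.q = true := by
  have h0 := h.side c hc
  have h1 := hb.adj (h.c1 hc)
  have h2 := hb.adj (h.c2 hc)
  have h3 := hb.adj (h.c3 hc)
  rw [h0] at h1
  rw [h1] at h2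
  rw [h2] at h3
  exact ⟨h0, h1, h2, h3⟩

lemma Sys.e3K {σ : V → Bool} {E : Finset (Sym2 V)} {C : Multiset (Core V)}
    {K : Multiset (V × V)} (h : Sys σ E.val C K) {c : Core V} (hc : c ∈ C) {k : V × V}
    (hk : k ∈ K) : s(c.y, c.q) ≠ s(k.1, k.2) := by
  intro he
  have hn : (cEdges C + kEdges K).Nodup := by rw [h.edges]; exact E.nodup
  have := (Multiset.nodup_add.1 hn).2.2
  have hm : s(c.y, c.q) ∈ cEdges C := by
    simp only [cEdges, Multiset.mem_add, Multiset.mem_map]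
    exact Or.inr ⟨c, hc, rfl⟩
  refine Multiset.disjoint_left.1 this hm ?_
  rw [he]; exact Multiset.mem_map.2 ⟨k, hk, rfl⟩

lemma Sys.e3inj {σ : V → Bool} {E : Finset (Sym2 V)} {C : Multiset (Core V)}
    {K : Multiset (V × V)} (h : Sys σ E.val C K) {c c' : Core V} (hc : c ∈ C) (hc' : c' ∈ C)
    (he : s(c.y, c.q) = s(c'.y, c'.q)) : c = c' := by
  have hn : (cEdges C + kEdges K).Nodup := by rw [h.edges]; exact E.nodup
  have := (Multiset.nodup_add.1 (Multiset.nodup_add.1 hn).1).2.1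
  exact Multiset.inj_on_of_nodup_map this c hc c' hc' he

lemma Sys.kn {σ : V → Bool} {E : Finset (Sym2 V)} {C : Multiset (Core V)}
    {K : Multiset (V × V)} (h : Sys σ E.val C K) : (kEdges K).Nodup := by
  have hn : (cEdges C + kEdges K).Nodup := by rw [h.edges]; exact E.nodup
  exact (Multiset.nodup_add.1 hn).2.1

lemma move {σ : V → Bool} {E : Finset (Sym2 V)} (hb : Bip σ E) {w y : V} {K0 : Multiset (V × V)} :
    ∀ n C b, Sys σ E.val C ((w, b) ::ₘ K0) → Rch C w n b y →
    ∃ C', Sys σ E.val C' ((w, y) ::ₘ K0) ∧ (b, w) ::ₘ prs C' = (y, w) ::ₘ prs C := by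
  intro n
  induction n with
  | zero =>
    rintro C b h rfl
    exact ⟨C, h, rfl⟩
  | succ n ih =>
    rintro C b h ⟨x, z, hc, hr⟩
    have hsd := h.sides hb hc
    simp only at hsd
    have hno : ∀ z x, (⟨z, x, b, w⟩ : Core V) ∉ C := by
      intro z x hz
      exact h.e3K hz (Multiset.mem_cons_self _ _) Sym2.eq_swap
    have hzb : z ≠ b := by
      rintro rfl
      exact hno _ _ hc
    obtain ⟨C0, rfl⟩ := Multiset.exists_cons_of_mem hc
    have hS : Sys σ E.val ((⟨z, x, b, w⟩ : Core V) ::ₘ C0) ((w, z) ::ₘ K0) := by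
      refine ⟨?_, ?_, ?_⟩
      · rw [← h.edges]
        simp only [cEdges, kEdges, Multiset.map_cons, Core.e1, Core.e2, Core.e3]
        rw [Sym2.eq_swap (a := z) (b := x), Sym2.eq_swap (a := x) (b := b),
          Sym2.eq_swap (a := b) (b := w), Sym2.eq_swap (a := w) (b := z)]
        simp only [← Multiset.singleton_add]
        abel
      · have := h.bal
        simp only [ends, Multiset.map_cons] at this ⊢
        simp only [← Multiset.singleton_add] at this ⊢
        rw [add_assoc] at this ⊢
        rw [add_left_cancel this]
      · intro c hc
        rcases Multiset.mem_cons.1 hc with rfl | hc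
        · exact hsd.2.2.1
        · exact h.side c (Multiset.mem_cons_of_mem hc)
    obtain ⟨C', h1, h2⟩ := ih _ z hS (rch_mono (b := b) hno (by
      intro c hc hp
      rcases Multiset.mem_cons.1 hc with rfl | hc
      · exact absurd rfl hp
      · exact Multiset.mem_cons_of_mem hc) y n z hzb hr)
    refine ⟨C', h1, ?_⟩
    have h3 := congrArg (fun M => (b, w) ::ₘ M) h2
    simp only [prs, Multiset.map_cons] at h3 ⊢
    rw [Multiset.cons_swap, Multiset.cons_swap (b, w) (y, w),
      Multiset.cons_swap (b, w) (z, w), Multiset.cons_swap (y, w) (z, w)] at h3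
    exact (Multiset.cons_inj_right _).1 h3

lemma exists_nonex {σ : V → Bool} {E : Finset (Sym2 V)} (hb : Bip σ E) {C : Multiset (Core V)}
    {K : Multiset (V × V)} (h : Sys σ E.val C K) {w b : V} (hk : (w, b) ∈ K) (hσ : σ b = false)
    (h1 : ∀ v, v ∈ ends C) :
    ∃ n y, Rch C w n b y ∧ ∃ q, q ≠ w ∧ (y, q) ∈ prs C := by
  classical
  by_contra hcon
  push Not at hcon
  let A : V → V → Prop := fun z z1 => ∃ x, (⟨z, x, z1, w⟩ : Core V) ∈ C
  have conv : ∀ b z, Relation.ReflTransGen A b z → ∃ n, Rch C w n b z := by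
    clear hcon hk hσ b
    intro b z hz
    induction hz using Relation.ReflTransGen.head_induction_on with
    | refl => exact ⟨0, rfl⟩
    | head h' _ ih =>
      obtain ⟨n, hn⟩ := ih
      obtain ⟨x, hx⟩ := h'
      exact ⟨n + 1, x, _, hx, hn⟩
  have key : ∀ z, Relation.ReflTransGen A b z → ∃ z1, A z z1 := by
    intro z hz
    obtain ⟨n, hn⟩ := conv b z hz
    have hσz : σ z = false := by
      rcases Relation.ReflTransGen.cases_tail hz with rfl | ⟨u, _, x, hx⟩
      · exact hσ
      · exact (h.sides hb hx).2.2.1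
    have := h1 z
    unfold ends at this
    rcases Multiset.mem_add.1 this with h' | h'
    · obtain ⟨c, hc, rfl⟩ := Multiset.mem_map.1 h'
      have hq : c.q = w := by
        by_contra hq
        exact hcon n c.p hn c.q hq (Multiset.mem_map.2 ⟨c, hc, rfl⟩)
      exact ⟨c.y, c.x, by rw [← hq]; exact hc⟩
    · obtain ⟨c, hc, rfl⟩ := Multiset.mem_map.1 h'
      have := (h.sides hb hc).2.2.2
      rw [hσz] at this
      cases this
  let Z := {z // Relation.ReflTransGen A b z}
  choose! η hη using key
  let f : Z → Z := fun z => ⟨η z.1, z.2.tail (hη z.1 z.2)⟩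
  have hf : Function.Injective f := by
    intro z z' he
    have he' : η z.1 = η z'.1 := congrArg Subtype.val he
    obtain ⟨x, hx⟩ := hη z.1 z.2
    obtain ⟨x', hx'⟩ := hη z'.1 z'.2
    have := h.e3inj hx hx' (by simp only [he'])
    exact Subtype.ext (congrArg Core.p this)
  obtain ⟨z, hz⟩ := (Finite.surjective_of_injective hf) ⟨b, Relation.ReflTransGen.refl⟩
  have hz' : η z.1 = b := congrArg Subtype.val hz
  obtain ⟨x, hx⟩ := hη z.1 z.2
  rw [hz'] at hx
  exact h.e3K hx hk Sym2.eq_swap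

def Inv (D K : Multiset (V × V)) : Prop :=
  (∀ v, 1 ≤ (en D).count v) ∧ ∀ v, Bad D K v → 2 ≤ (en D).count v

/-- one improvement step -/
lemma improve {σ : V → Bool} {E : Finset (Sym2 V)} (hb : Bip σ E) {C : Multiset (Core V)}
    {K : Multiset (V × V)} (h : Sys σ E.val C K) (hI : Inv (prs C) K) {b : V}
    (hσ : σ b = false) (hbad : Bad (prs C) K b) :
    ∃ C' K', Sys σ E.val C' K' ∧ Inv (prs C') K' ∧ (∀ v, Bad (prs C') K' v → Bad (prs C) K v) ∧
      ¬ Bad (prs C') K' b := by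
  have h2b := hI.2 b hbad
  obtain ⟨w, hk, hw⟩ := hbad
  have hall : ∀ v, v ∈ ends C := by
    intro v
    rw [ends_eq, ← Multiset.one_le_count_iff_mem]; exact hI.1 v
  obtain ⟨n, y, hr, q, hqw, hyq⟩ := exists_nonex hb h hk hσ hall
  have hwb : w ≠ b := hb.ne (h.ck hk)
  have hbq : (b, w) ∈ prs C := by
    have := hall b
    rw [ends_eq, en, Multiset.mem_add, Multiset.mem_map, Multiset.mem_map] at this
    rcases this with ⟨d, hd, hdb⟩ | ⟨d, hd, hdb⟩
    · have := (hw d hd).1 hdb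
      rw [← hdb, ← this]; exact hd
    · obtain ⟨c, hc, rfl⟩ := Multiset.mem_map.1 hd
      have := (h.sides hb hc).2.2.2
      simp only at hdb
      rw [hdb, hσ] at this
      cases this
  have hyb : y ≠ b := by
    rintro rfl
    exact hqw ((hw _ hyq).1 rfl)
  obtain ⟨K0, rfl⟩ := Multiset.exists_cons_of_mem hk
  obtain ⟨C', hS, hD⟩ := move hb n C b h hr
  obtain ⟨D0, hD0⟩ := Multiset.exists_cons_of_mem hbq
  have hD' : prs C' = (y, w) ::ₘ D0 := by
    rw [hD0, Multiset.cons_swap] at hD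
    exact (Multiset.cons_inj_right _).1 hD
  have hyq0 : (y, q) ∈ D0 := by
    rw [hD0] at hyq
    rcases Multiset.mem_cons.1 hyq with h' | h'
    · exact absurd (congrArg Prod.fst h') hyb
    · exact h'
  have hywK : w ≠ y := hb.ne (hS.ck (Multiset.mem_cons_self _ _))
  have kn := hS.kn
  have kn0 := h.kn
  simp only [kEdges, Multiset.map_cons, Multiset.nodup_cons] at kn kn0
  have cntD : ∀ v, (en (prs C)).count v = (en D0).count v + (if v = b then 1 else 0) +
      (if v = w then 1 else 0) := by
    intro v
    rw [hD0]
    simp only [en, Multiset.map_cons, Multiset.count_add, Multiset.count_cons]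
    omega
  have cntD' : ∀ v, (en (prs C')).count v = (en D0).count v + (if v = y then 1 else 0) +
      (if v = w then 1 else 0) := by
    intro v
    rw [hD']
    simp only [en, Multiset.map_cons, Multiset.count_add, Multiset.count_cons]
    omega
  have c0b : 1 ≤ (en D0).count b := by
    have := cntD b
    rw [if_pos rfl, if_neg hwb.symm] at this
    omega
  have nb : ¬ Bad (prs C') ((w, y) ::ₘ K0) b := by
    rintro ⟨u, hu, hu'⟩
    have hu0 : (u, b) ∈ K0 := by
      rcases Multiset.mem_cons.1 hu with h' | h'
      · exact absurd (congrArg Prod.snd h').symm hyb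
      · exact h'
    have : b ∈ en D0 := Multiset.one_le_count_iff_mem.1 c0b
    rw [en, Multiset.mem_add, Multiset.mem_map, Multiset.mem_map] at this
    have huw : u = w := by
      rcases this with ⟨d, hd, hdb⟩ | ⟨d, hd, hdb⟩
      · rw [← (hu' d (by rw [hD']; exact Multiset.mem_cons_of_mem hd)).1 hdb]
        exact (hw d (by rw [hD0]; exact Multiset.mem_cons_of_mem hd)).1 hdb
      · rw [← (hu' d (by rw [hD']; exact Multiset.mem_cons_of_mem hd)).2 hdb]
        exact (hw d (by rw [hD0]; exact Multiset.mem_cons_of_mem hd)).2 hdb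
    subst huw
    exact kn0.1 (Multiset.mem_map.2 ⟨_, hu0, rfl⟩)
  have ny : ¬ Bad (prs C') ((w, y) ::ₘ K0) y := by
    rintro ⟨u, hu, hu'⟩
    have e1 := (hu' (y, w) (by rw [hD']; exact Multiset.mem_cons_self _ _)).1 rfl
    have e2 := (hu' (y, q) (by rw [hD']; exact Multiset.mem_cons_of_mem hyq0)).1 rfl
    exact hqw (e2.trans e1.symm)
  have nw : ¬ Bad (prs C') ((w, y) ::ₘ K0) w := by
    rintro ⟨u, hu, hu'⟩
    have e1 := (hu' (y, w) (by rw [hD']; exact Multiset.mem_cons_self _ _)).2 rfl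
    simp only at e1
    subst e1
    rcases Multiset.mem_cons.1 hu with h' | h'
    · exact hywK (congrArg Prod.snd h')
    · exact kn.1 (Multiset.mem_map.2 ⟨_, h', Sym2.eq_swap⟩)
  have mono : ∀ v, Bad (prs C') ((w, y) ::ₘ K0) v → Bad (prs C) ((w, b) ::ₘ K0) v := by
    intro v hv
    have vb : v ≠ b := by rintro rfl; exact nb hv
    have vy : v ≠ y := by rintro rfl; exact ny hv
    have vw : v ≠ w := by rintro rfl; exact nw hv
    obtain ⟨u, hu, hu'⟩ := hv
    refine ⟨u, ?_, ?_⟩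
    · rcases Multiset.mem_cons.1 hu with h' | h'
      · exact absurd (congrArg Prod.snd h') vy
      · exact Multiset.mem_cons_of_mem h'
    · intro d hd
      rw [hD0] at hd
      rcases Multiset.mem_cons.1 hd with rfl | hd
      · exact ⟨fun h => absurd h.symm vb, fun h => absurd h.symm vw⟩
      · exact hu' d (by rw [hD']; exact Multiset.mem_cons_of_mem hd)
  refine ⟨C', _, hS, ⟨?_, ?_⟩, mono, nb⟩
  · intro v
    have e1 := cntD v
    have e2 := cntD' v
    have e3 := hI.1 v
    by_cases vb : v = b
    · subst vb; omega
    · rw [if_neg vb] at e1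
      omega
  · intro v hv
    have vb : v ≠ b := by rintro rfl; exact nb hv
    have e1 := cntD v
    have e2 := cntD' v
    have e3 := hI.2 v (mono v hv)
    rw [if_neg vb] at e1
    omega

def Core.rev {V : Type} (c : Core V) : Core V := ⟨c.q, c.y, c.x, c.p⟩

lemma prs_rev (C : Multiset (Core V)) : prs (C.map Core.rev) = (prs C).map Prod.swap := by
  simp only [prs, Multiset.map_map]; rfl

lemma Sys.rev {σ : V → Bool} {E : Finset (Sym2 V)} (hb : Bip σ E) {C : Multiset (Core V)}
    {K : Multiset (V × V)} (h : Sys σ E.val C K) :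
    Sys (fun v => !σ v) E.val (C.map Core.rev) K := by
  have r1 : Core.e1 ∘ Core.rev = (Core.e3 : Core V → _) := by funext c; exact Sym2.eq_swap
  have r2 : Core.e2 ∘ Core.rev = (Core.e2 : Core V → _) := by funext c; exact Sym2.eq_swap
  have r3 : Core.e3 ∘ Core.rev = (Core.e1 : Core V → _) := by funext c; exact Sym2.eq_swap
  refine ⟨?_, ?_, ?_⟩
  · rw [← h.edges]
    simp only [cEdges, Multiset.map_map, r1, r2, r3]
    abel
  · rw [← h.bal]
    simp only [ends, Multiset.map_map]
    rw [add_comm]; rfl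
  · intro c hc
    obtain ⟨c, hc', rfl⟩ := Multiset.mem_map.1 hc
    simp [Core.rev, (h.sides hb hc').2.2.2]

lemma bad_rev (D K : Multiset (V × V)) (v : V) : Bad (D.map Prod.swap) K v ↔ Bad D K v := by
  unfold Bad
  refine exists_congr fun w => and_congr_right fun _ => ?_
  constructor
  · intro h d hd
    have := h d.swap (Multiset.mem_map_of_mem _ hd)
    exact ⟨this.2, this.1⟩
  · intro h d hd
    obtain ⟨d, hd', rfl⟩ := Multiset.mem_map.1 hd
    exact ⟨(h d hd').2, (h d hd').1⟩

lemma en_rev (D : Multiset (V × V)) : en (D.map Prod.swap) = en D := by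
  simp only [en, Multiset.map_map]
  rw [add_comm]; rfl

lemma phase2 {E : Finset (Sym2 V)} : ∀ n (σ : V → Bool), Bip σ E → ∀ C K, Sys σ E.val C K →
    Inv (prs C) K → (open Classical in (Finset.univ.filter (Bad (prs C) K)).card) = n →
    ∃ σ' C' K', Bip σ' E ∧ Sys σ' E.val C' K' ∧ ∀ v, ¬ Bad (prs C') K' v := by
  classical
  intro n
  induction n using Nat.strong_induction_on with
  | _ n ih =>
  intro σ hb C K h hI hn
  by_cases hex : ∃ v, Bad (prs C) K v
  · obtain ⟨v, hv⟩ := hex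
    have main : ∀ (σ : V → Bool), Bip σ E → ∀ C K, Sys σ E.val C K →
        Inv (prs C) K → (Finset.univ.filter (Bad (prs C) K)).card = n → Bad (prs C) K v →
        σ v = false →
        ∃ σ' C' K', Bip σ' E ∧ Sys σ' E.val C' K' ∧ ∀ v, ¬ Bad (prs C') K' v := by
      intro σ hb C K h hI hn hv hσ
      obtain ⟨C', K', h1, h2, h3, h4⟩ := improve hb h hI hσ hv
      refine ih _ ?_ σ hb C' K' h1 h2 rfl
      rw [← hn]
      refine Finset.card_lt_card ⟨?_, ?_⟩
      · intro u hu
        simp only [Finset.mem_filter, Finset.mem_univ, true_and] at hu ⊢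
        exact h3 u hu
      · intro hsub
        have := hsub (x := v) (by simpa using hv)
        exact h4 (by simpa using this)
    cases hσ : σ v
    · exact main σ hb C K h hI hn hv hσ
    · refine main _ hb.neg _ K (h.rev hb) ?_ ?_ ?_ (by simp [hσ])
      · simp only [Inv, prs_rev, bad_rev, en_rev]; exact hI
      · simp only [prs_rev, bad_rev]; exact hn
      · rw [prs_rev, bad_rev]; exact hv
  · push Not at hex
    exact ⟨σ, C, K, hb, h, hex⟩

end P5

namespace P5

variable {V : Type} [Fintype V] [DecidableEq V]

lemma assign {ι : Type} [Fintype ι] [DecidableEq ι] (en ot : ι → V) (K : Finset (V × V))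
    (hcard : ∀ v, (Finset.univ.filter (fun i => en i = v)).card = (K.filter (fun k => k.2 = v)).card)
    (hbad : ∀ v w, (w, v) ∈ K → ∃ i, en i = v ∧ ot i ≠ w) :
    ∃ g : ι → V × V, Function.Injective g ∧ ∀ i, g i ∈ K ∧ (g i).2 = en i ∧ (g i).1 ≠ ot i := by
  have hall : ∀ v, ∃ f : {i // en i = v} → V × V, Function.Injective f ∧
      ∀ i, f i ∈ (K.filter (fun k => k.2 = v)).erase (ot i.1, v) := by
    intro v
    rw [← Finset.all_card_le_biUnion_card_iff_exists_injective]
    intro S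
    have hle : (Finset.univ : Finset {i // en i = v}).card = (K.filter (fun k => k.2 = v)).card := by
      rw [← hcard v, Finset.card_univ, Fintype.card_subtype]
    rcases S.eq_empty_or_nonempty with rfl | ⟨i, hi⟩
    · simp
    by_cases hex : ∃ j ∈ S, ot j.1 ≠ ot i.1
    · obtain ⟨j, hj, hne⟩ := hex
      refine (Finset.card_le_univ S).trans (le_of_eq_of_le hle (Finset.card_le_card ?_))
      intro k hk
      rw [Finset.mem_biUnion]
      by_cases h : k = (ot i.1, v)
      · refine ⟨j, hj, Finset.mem_erase.2 ⟨?_, hk⟩⟩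
        rw [h]
        intro h'
        exact hne (congrArg Prod.fst h').symm
      · exact ⟨i, hi, Finset.mem_erase.2 ⟨h, hk⟩⟩
    · push Not at hex
      have hsub : (K.filter (fun k => k.2 = v)).erase (ot i.1, v) ⊆
          S.biUnion (fun i => (K.filter (fun k => k.2 = v)).erase (ot i.1, v)) :=
        Finset.subset_biUnion_of_mem
          (fun i : {i // en i = v} => (K.filter (fun k => k.2 = v)).erase (ot i.1, v)) hi
      refine le_trans ?_ (Finset.card_le_card hsub)
      by_cases hm : (ot i.1, v) ∈ K
      · obtain ⟨j, hj, hne⟩ := hbad _ _ hm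
        have hjS : (⟨j, hj⟩ : {i // en i = v}) ∉ S := fun h => hne (hex _ h)
        have hlt : S.card < (Finset.univ : Finset {i // en i = v}).card :=
          Finset.card_lt_card (Finset.ssubset_univ_iff.2 (fun h => hjS (h ▸ Finset.mem_univ _)))
        rw [Finset.card_erase_of_mem (by simp [hm])]
        omega
      · rw [Finset.erase_eq_of_notMem (by simp [hm]), ← hle]
        exact Finset.card_le_univ S
  choose f hf hf' using hall
  refine ⟨fun i => f (en i) ⟨i, rfl⟩, ?_, ?_⟩
  · intro i j hij
    simp only at hij
    have h1 := hf' (en i) ⟨i, rfl⟩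
    have h2 := hf' (en j) ⟨j, rfl⟩
    have e1 := (Finset.mem_filter.1 (Finset.mem_of_mem_erase h1)).2
    have e2 := (Finset.mem_filter.1 (Finset.mem_of_mem_erase h2)).2
    have hen : en i = en j := by rw [← e1, ← e2, hij]
    have aux : ∀ v (h : en j = v), f (en j) ⟨j, rfl⟩ = f v ⟨j, h⟩ := by
      rintro v rfl; rfl
    rw [aux (en i) hen.symm] at hij
    exact congrArg Subtype.val (hf _ hij)
  · intro i
    have h1 := hf' (en i) ⟨i, rfl⟩
    have e1 := Finset.mem_filter.1 (Finset.mem_of_mem_erase h1)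
    refine ⟨e1.1, e1.2, fun h => Finset.ne_of_mem_erase h1 (Prod.ext h e1.2)⟩

lemma path_edges (e : Sym2 (Fin 6)) :
    e ∈ (pathGraph 6).edgeSet ↔ ∃ i : Fin 5, e = s(i.castSucc, i.succ) := by
  induction e using Sym2.ind with
  | _ a b =>
  rw [mem_edgeSet, pathGraph_adj]
  constructor
  · rintro (h | h)
    · refine ⟨⟨a.1, by omega⟩, ?_⟩
      congr 1
      ext
      simp [h]
    · refine ⟨⟨b.1, by omega⟩, ?_⟩
      rw [Sym2.eq_swap]
      congr 1
      ext
      simp [h]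
  · rintro ⟨i, h⟩
    rcases Sym2.eq_iff.1 h with ⟨rfl, rfl⟩ | ⟨rfl, rfl⟩ <;> simp

/-- Reduction of a decomposition to indexed paths. -/
lemma decomp_of_paths {G : SimpleGraph V} {J : Type} (w : J → Fin 6 → V)
    (hinj : ∀ j, Function.Injective (w j))
    (hF : Function.Injective (fun t : J × Fin 5 => s(w t.1 t.2.castSucc, w t.1 t.2.succ)))
    (hr : Set.range (fun t : J × Fin 5 => s(w t.1 t.2.castSucc, w t.1 t.2.succ)) = G.edgeSet) :
    ∃ D : Set G.Subgraph, IsDecompInto G (pathGraph 6) D := by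
  have hadj : ∀ j (i : Fin 5), s(w j i.castSucc, w j i.succ) ∈ G.edgeSet := by
    intro j i
    rw [← hr]; exact ⟨(j, i), rfl⟩
  let cp : J → Copy (pathGraph 6) G := fun j =>
    ⟨⟨w j, by
      intro a b hab
      obtain ⟨i, hi⟩ := (path_edges s(a, b)).1 hab
      have := hadj j i
      rcases Sym2.eq_iff.1 hi with ⟨rfl, rfl⟩ | ⟨rfl, rfl⟩
      · exact this
      · exact G.adj_symm this⟩, hinj j⟩
  have hes : ∀ j, (cp j).toSubgraph.edgeSet =
      Set.range (fun i : Fin 5 => s(w j i.castSucc, w j i.succ)) := by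
    intro j
    rw [Copy.toSubgraph, Subgraph.edgeSet_map]
    ext e
    simp only [Set.mem_image, Set.mem_range, Subgraph.edgeSet_top, path_edges]
    constructor
    · rintro ⟨_, ⟨i, rfl⟩, rfl⟩
      exact ⟨i, rfl⟩
    · rintro ⟨i, rfl⟩
      exact ⟨_, ⟨i, rfl⟩, rfl⟩
  refine ⟨Set.range fun j => (cp j).toSubgraph, ?_, ?_, ?_⟩
  · rintro _ ⟨j, rfl⟩
    exact ⟨(cp j).isoToSubgraph.symm⟩
  · rintro _ ⟨j, rfl⟩ _ ⟨j', rfl⟩ hne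
    rw [Set.disjoint_left]
    simp only [hes]
    rintro e ⟨i, rfl⟩ ⟨i', h⟩
    have := hF (a₁ := (j', i')) (a₂ := (j, i)) h
    apply hne
    have hj : j' = j := congrArg Prod.fst this
    subst hj
    rfl
  · rw [← hr]
    ext e
    simp only [Set.mem_iUnion, Set.mem_range, exists_prop, exists_exists_eq_and, hes, Prod.exists]

lemma final {G : SimpleGraph V} {σ : V → Bool} {E : Finset (Sym2 V)}
    (hE : (E : Set (Sym2 V)) = G.edgeSet) (hb : Bip σ E)
    {C : Multiset (Core V)} {K : Multiset (V × V)} (h : Sys σ E.val C K)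
    (hbad : ∀ v, ¬ Bad (prs C) K v) :
    ∃ D : Set G.Subgraph, IsDecompInto G (pathGraph 6) D := by
  classical
  have hn : (cEdges C + kEdges K).Nodup := by rw [h.edges]; exact E.nodup
  have hCn : C.Nodup := Multiset.Nodup.of_map _ (Multiset.nodup_add.1 (Multiset.nodup_add.1 hn).1).2.1
  have hKn : K.Nodup := Multiset.Nodup.of_map _ h.kn
  let Cf : Finset (Core V) := ⟨C, hCn⟩
  let Kf : Finset (V × V) := ⟨K, hKn⟩
  let en : Cf × Bool → V := fun i => if i.2 then i.1.1.q else i.1.1.p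
  let ot : Cf × Bool → V := fun i => if i.2 then i.1.1.p else i.1.1.q
  have hcard : ∀ v, (Finset.univ.filter (fun i => en i = v)).card =
      (Kf.filter (fun k => k.2 = v)).card := by
    intro v
    have hc := congrArg (Multiset.count v) h.bal
    rw [ends, Multiset.count_add, Multiset.count_map, Multiset.count_map, Multiset.count_map] at hc
    have e1 : (Multiset.filter (fun a : Core V => v = a.p) C).card =
        ∑ c ∈ Cf, if c.p = v then 1 else 0 := by
      rw [← Finset.card_filter]
      simp only [eq_comm (a := v)]; rfl
    have e2 : (Multiset.filter (fun a : Core V => v = a.q) C).card =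
        ∑ c ∈ Cf, if c.q = v then 1 else 0 := by
      rw [← Finset.card_filter]
      simp only [eq_comm (a := v)]; rfl
    have e3 : (Multiset.filter (fun a : V × V => v = a.2) K).card =
        (Kf.filter (fun k => k.2 = v)).card := by
      simp only [eq_comm (a := v)]; rfl
    rw [e1, e2, e3] at hc
    rw [← hc, Finset.card_filter, Fintype.sum_prod_type, ← Finset.sum_add_distrib,
      ← Finset.sum_coe_sort Cf]
    refine Finset.sum_congr rfl fun c _ => ?_
    rw [Fintype.sum_bool]
    simp only [en, if_true, Bool.false_eq_true, if_false]
    exact add_comm _ _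
  obtain ⟨g, ginj, hg⟩ := assign en ot Kf hcard (by
    intro v w hk
    by_contra hcon
    push Not at hcon
    refine hbad v ⟨w, hk, ?_⟩
    intro d hd
    obtain ⟨c, hc, rfl⟩ := Multiset.mem_map.1 hd
    exact ⟨fun hp => hcon (⟨c, hc⟩, false) hp, fun hq => hcon (⟨c, hc⟩, true) hq⟩)
  have hKc : Fintype.card (Cf × Bool) = Kf.card := by
    have hc := congrArg Multiset.card h.bal
    simp only [ends, Multiset.card_add, Multiset.card_map] at hc
    rw [Fintype.card_prod, Fintype.card_coe, Fintype.card_bool]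
    change C.card * 2 = K.card
    omega
  have gimg : Finset.univ.image g = Kf := by
    refine Finset.eq_of_subset_of_card_le ?_ ?_
    · intro k hk
      obtain ⟨i, _, rfl⟩ := Finset.mem_image.1 hk
      exact (hg i).1
    · rw [Finset.card_image_of_injective _ ginj, Finset.card_univ, hKc]
  let w : Cf → Fin 6 → V := fun c =>
    ![(g (c, false)).1, c.1.p, c.1.x, c.1.y, c.1.q, (g (c, true)).1]
  let F : Cf × Fin 5 → Sym2 V := fun t => s(w t.1 t.2.castSucc, w t.1 t.2.succ)
  have F0 : ∀ c, F (c, 0) = s((g (c, false)).1, c.1.p) := fun c => rfl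
  have F1 : ∀ c, F (c, 1) = s(c.1.p, c.1.x) := fun c => rfl
  have F2 : ∀ c, F (c, 2) = s(c.1.x, c.1.y) := fun c => rfl
  have F3 : ∀ c, F (c, 3) = s(c.1.y, c.1.q) := fun c => rfl
  have F4 : ∀ c, F (c, 4) = s(c.1.q, (g (c, true)).1) := fun c => rfl
  have g0 : ∀ c : Cf, (g (c, false)).2 = c.1.p := fun c => (hg (c, false)).2.1
  have g1 : ∀ c : Cf, (g (c, true)).2 = c.1.q := fun c => (hg (c, true)).2.1
  have k0 : ∀ c : Cf, F (c, 0) ∈ E := fun c => by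
    rw [F0, ← g0]; exact h.ck (hg (c, false)).1
  have k4 : ∀ c : Cf, F (c, 4) ∈ E := fun c => by
    rw [F4, ← g1, Sym2.eq_swap]; exact h.ck (hg (c, true)).1
  have hFE : ∀ t, F t ∈ E := by
    rintro ⟨c, i⟩
    fin_cases i
    · exact k0 c
    · exact h.c1 c.2
    · exact h.c2 c.2
    · exact h.c3 c.2
    · exact k4 c
  have hsurj : ∀ e ∈ E, ∃ t, F t = e := by
    intro e he
    rw [← Finset.mem_val, ← h.edges] at he
    simp only [cEdges, kEdges, Multiset.mem_add, Multiset.mem_map] at he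
    rcases he with ((⟨c, hc, rfl⟩ | ⟨c, hc, rfl⟩) | ⟨c, hc, rfl⟩) | ⟨k, hk, rfl⟩
    · exact ⟨(⟨c, hc⟩, 1), rfl⟩
    · exact ⟨(⟨c, hc⟩, 2), rfl⟩
    · exact ⟨(⟨c, hc⟩, 3), rfl⟩
    · have hk' : k ∈ Finset.univ.image g := by rw [gimg]; exact hk
      obtain ⟨⟨c, s⟩, _, rfl⟩ := Finset.mem_image.1 hk'
      cases s
      · exact ⟨(c, 0), by rw [F0, g0]⟩
      · exact ⟨(c, 4), by rw [F4, g1, Sym2.eq_swap]⟩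
  have himg : Finset.univ.image F = E := by
    ext e
    simp only [Finset.mem_image, Finset.mem_univ, true_and]
    exact ⟨by rintro ⟨t, rfl⟩; exact hFE t, hsurj e⟩
  have hFinj : Function.Injective F := by
    have hc : (Finset.univ.image F).card = (Finset.univ : Finset (Cf × Fin 5)).card := by
      rw [himg, Finset.card_univ, Fintype.card_prod, Fintype.card_coe, Fintype.card_fin]
      have h1 := congrArg Multiset.card h.edges
      simp only [cEdges, kEdges, Multiset.card_add, Multiset.card_map] at h1
      rw [Fintype.card_prod, Fintype.card_coe, Fintype.card_bool] at hKc
      change C.card * 2 = K.card at hKc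
      change E.val.card = C.card * 5
      omega
    have := Finset.card_image_iff.1 hc
    simpa using this
  refine decomp_of_paths w ?_ hFinj ?_
  · intro c
    obtain ⟨s1, s2, s3, s4⟩ := h.sides hb c.2
    have s0 : σ (g (c, false)).1 = true := by
      have := hb.adj (x := (g (c, false)).1) (y := c.1.p) (k0 c)
      rw [s1] at this
      simpa using this.symm
    have s5 : σ (g (c, true)).1 = false := by
      have := hb.adj (x := c.1.q) (y := (g (c, true)).1) (k4 c)
      rw [s4] at this
      simpa using this
    have o1 : (g (c, false)).1 ≠ c.1.q := (hg (c, false)).2.2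
    have o2 : (g (c, true)).1 ≠ c.1.p := (hg (c, true)).2.2
    have ne : ∀ i j : Fin 5, i ≠ j → F (c, i) ≠ F (c, j) := by
      intro i j hij he
      exact hij (congrArg Prod.snd (hFinj he))
    have n1 : (g (c, false)).1 ≠ c.1.x := by
      intro he
      apply ne 0 1 (by decide)
      rw [F0, F1, he, Sym2.eq_swap]
    have n2 : c.1.p ≠ c.1.y := by
      intro he
      apply ne 1 2 (by decide)
      rw [F1, F2, he, Sym2.eq_swap]
    have n3 : c.1.x ≠ c.1.q := by
      intro he
      apply ne 2 3 (by decide)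
      rw [F2, F3, he, Sym2.eq_swap]
    have n4 : c.1.y ≠ (g (c, true)).1 := by
      intro he
      apply ne 3 4 (by decide)
      rw [F3, F4, he, Sym2.eq_swap]
    have sn : ∀ {a b : V}, σ a = true → σ b = false → a ≠ b := by
      rintro a b ha hb' rfl
      rw [ha] at hb'
      cases hb'
    have key : ∀ i j : Fin 6, i < j → w c i ≠ w c j := by
      intro i j hij
      fin_cases i <;> fin_cases j <;> first
        | exact absurd hij (by decide)
        | exact n1
        | exact n2
        | exact n3
        | exact n4
        | exact o1
        | exact o2.symm
        | exact sn s0 s1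
        | exact sn s0 s3
        | exact sn s0 s5
        | exact sn s2 s3
        | exact sn s2 s5
        | exact sn s4 s5
        | exact (sn s2 s1).symm
        | exact (sn s4 s1).symm
        | exact (sn s4 s3).symm
    intro i j hij
    rcases lt_trichotomy i j with hl | hl | hl
    · exact absurd hij (key i j hl)
    · exact hl
    · exact absurd hij.symm (key j i hl)
  · rw [← hE]
    ext e
    constructor
    · rintro ⟨t, rfl⟩
      exact hFE t
    · intro he
      exact hsurj e he

end P5

/-- If `G` is a `48`-edge-connected bipartite finite simple graph and the number of
edges of `G` is divisible by `5`, then `G` admits a `P₅`-decomposition. -/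
theorem p5_decomposition_of_48_edge_connected_bipartite
    {V : Type} [Fintype V] (G : SimpleGraph V)
    (hbip : G.Colorable 2)
    (hconn : IsKEdgeConnected G 48)
    (hdiv : 5 ∣ G.edgeSet.ncard) :
    ∃ D : Set G.Subgraph, IsDecompInto G (pathGraph 6) D := by
  classical
  obtain ⟨κ⟩ := hbip
  let σ : V → Bool := fun v => decide (κ v = 0)
  have hE : (G.edgeFinset : Set (Sym2 V)) = G.edgeSet := G.coe_edgeFinset
  have hb : P5.Bip σ G.edgeFinset := by
    intro e
    induction e using Sym2.ind with
    | _ a b =>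
    intro he
    have hadj : G.Adj a b := by simpa using he
    have hne := κ.valid hadj
    by_cases h0 : κ a = 0
    · refine ⟨a, b, by simp [σ, h0], ?_, rfl⟩
      simp only [σ, decide_eq_false_iff_not]
      intro h1
      exact hne (h0.trans h1.symm)
    · refine ⟨b, a, ?_, by simp [σ, h0], Sym2.eq_swap⟩
      simp only [σ, decide_eq_true_eq]
      have := (κ a).2
      have := (κ b).2
      have h3 : (κ a).1 ≠ (κ b).1 := fun h => hne (Fin.ext h)
      have h4 : (κ a).1 ≠ 0 := fun h => h0 (Fin.ext h)
      apply Fin.ext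
      show (κ b).1 = 0
      omega
  by_cases hem : G.edgeFinset = ∅
  · refine ⟨∅, by simp, by simp, ?_⟩
    rw [← hE, hem]; simp
  · obtain ⟨e, he⟩ := Finset.nonempty_iff_ne_empty.2 hem
    obtain ⟨a, b0, ha, hb0, rfl⟩ := hb e he
    haveI : Nontrivial V := ⟨⟨a, b0, hb.ne he⟩⟩
    obtain ⟨S⟩ := P5.setup hconn G.edgeFinset hE hb
    have h5 : 5 ∣ G.edgeFinset.card := by
      rw [← hE, Set.ncard_coe_finset] at hdiv; exact hdiv
    obtain ⟨D⟩ := P5.classes hb S b0 hb0 h5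
    obtain ⟨C, K, hS, h2⟩ := P5.sysE hb D
    have hI : P5.Inv (P5.prs C) K := by
      constructor
      · intro v
        have := h2 v
        rw [P5.ends_eq] at this
        omega
      · intro v _
        have := h2 v
        rwa [P5.ends_eq] at this
    obtain ⟨σ', C', K', hb', hS', hbad⟩ := P5.phase2 _ σ hb C K hS hI rfl
    exact P5.final hE hb' hS' hbad
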